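/- Let A,B ∈ ℝ^{3×3} with tr(A) = tr(B) = 0 and A − B = a ⊗ n for some a ∈ ℝ³ ∖ {0}, n ∈ S², and let M = λA + (1−λ)B for some λ ∈ (0,1). Then there is a universal constant C > 0 such that for every δ ∈ (0,1/2) there exist a diamond Ω_δ = x₀ + rQ(conv{±e₁, ±δe₂, ±e₃}) ⊂ ℝ³ (with x₀ ∈ ℝ³, r > 0, Q ∈ SO(3)) and a piecewise affine map u : Ω_δ → ℝ³ such that: (i) u(x) = Mx on ∂Ω_δ; (ii) div u = 0 a.e. in Ω_δ; (iii) dist(∇u, {A,B}) ≤ C·λ(1−λ)·δ·|a| a.e., and there are constants v_A, v_B ∈ (1/2,2) with |{x ∈ Ω_δ : dist(∇u(x),A) < dist(∇u(x),B)}| = v_A·λ·|Ω_δ| and |{x ∈ Ω_δ : dist(∇u(x),B) ≤ dist(∇u(x),A)}| = v_B·(1−λ)·|Ω_δ|; (iv) ∇u attains at most ten different values; (v) Ω_δ can be divided into 20 simplices on each of which u is affine; (vi) ‖u − Mx‖_{L^∞(Ω_δ)} ≤ C·δ·λ(1−λ)·|a|. -/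

import Mathlib

noncomputable section
open MeasureTheory Set ENNReal Matrix

abbrev Euc (n : ℕ) := EuclideanSpace ℝ (Fin n)
abbrev Mat (n : ℕ) := Matrix (Fin n) (Fin n) ℝ

/-- The Frobenius norm of a matrix. -/
def frobNorm {n : ℕ} (A : Mat n) : ℝ := Real.sqrt (∑ i, ∑ j, (A i j) ^ 2)

/-- The continuous linear map on Euclidean space induced by a matrix. -/
def matCLM {n : ℕ} (A : Mat n) : Euc n →L[ℝ] Euc n :=
  LinearMap.toContinuousLinearMap (Matrix.toEuclideanLin A)

/-- A matrix applied to a vector in Euclidean space. -/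
def matVec {n : ℕ} (A : Mat n) (x : Euc n) : Euc n := matCLM A x

/-- The vertices `±e₁, ±δe₂ (, ±e₃)` of the model diamond. -/
def diamondVertices (n : ℕ) (δ : ℝ) : Set (Euc n) :=
  {v | ∃ i : Fin n, v = (if (i : ℕ) = 1 then δ else 1) • EuclideanSpace.single i (1 : ℝ) ∨
       v = -((if (i : ℕ) = 1 then δ else 1) • EuclideanSpace.single i (1 : ℝ))}

/-- The model diamond `conv{±e₁, ±δe₂ (, ±e₃)}`. -/
def baseDiamond (n : ℕ) (δ : ℝ) : Set (Euc n) := convexHull ℝ (diamondVertices n δ)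

/-- A diamond of aspect ratio `1:δ` (resp. `1:δ:1`). -/
def IsDiamond (n : ℕ) (δ : ℝ) (Ω : Set (Euc n)) : Prop :=
  ∃ (x₀ : Euc n) (r : ℝ) (Q : Mat n), 0 < r ∧ Qᵀ * Q = 1 ∧ Q.det = 1 ∧
    Ω = (fun y => x₀ + r • matVec Q y) '' baseDiamond n δ

/-- A continuous map which is affine on each polytope of a finite cover of `Ω`. -/
def IsPiecewiseAffine {n : ℕ} (Ω : Set (Euc n)) (u : Euc n → Euc n) : Prop :=
  ContinuousOn u Ω ∧ ∃ (N : ℕ) (P : Fin N → Set (Euc n)),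
    (∀ i, ∃ S : Finset (Euc n), P i = convexHull ℝ (S : Set (Euc n))) ∧
    Ω ⊆ ⋃ i, P i ∧
    (∀ i, ∃ (f : Euc n →ₗ[ℝ] Euc n) (b : Euc n), ∀ x ∈ P i ∩ Ω, u x = f x + b)

/-- `B` is, up to Lebesgue null sets, partitioned by the family `P`. -/
def AEPartition {n : ℕ} {ι : Type*} (B : Set (Euc n)) (P : ι → Set (Euc n)) : Prop :=
  volume (B \ ⋃ i, P i) = 0 ∧ volume ((⋃ i, P i) \ B) = 0 ∧
  ∀ i j, i ≠ j → volume (P i ∩ P j) = 0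

section Simplices

theorem mem_convexHull_four {p q r s x : Euc 3} :
    x ∈ convexHull ℝ {p, q, r, s} ↔ ∃ α β γ ε : ℝ, 0 ≤ α ∧ 0 ≤ β ∧ 0 ≤ γ ∧ 0 ≤ ε ∧
      α + β + γ + ε = 1 ∧ ∀ i, x i = α * p i + β * q i + γ * r i + ε * s i := by
  constructor
  · intro hx
    let S : Set (Euc 3) := {x | ∃ α β γ ε : ℝ, 0 ≤ α ∧ 0 ≤ β ∧ 0 ≤ γ ∧ 0 ≤ ε ∧
      α + β + γ + ε = 1 ∧ ∀ i, x i = α * p i + β * q i + γ * r i + ε * s i}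
    have hS : Convex ℝ S := by
      rintro x ⟨α, β, γ, ε, h1, h2, h3, h4, h5, h6⟩ y ⟨α', β', γ', ε', k1, k2, k3, k4, k5, k6⟩
        a b ha hb hab
      refine ⟨a * α + b * α', a * β + b * β', a * γ + b * γ', a * ε + b * ε', by positivity,
        by positivity, by positivity, by positivity, ?_, fun i => ?_⟩
      · linear_combination a * h5 + b * k5 + hab
      · simp only [PiLp.add_apply, PiLp.smul_apply, smul_eq_mul, h6, k6]
        ring
    refine convexHull_min ?_ hS hx
    rintro y (rfl | rfl | rfl | rfl)
    · exact ⟨1, 0, 0, 0, by norm_num, by norm_num, by norm_num, by norm_num, by norm_num, by simp⟩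
    · exact ⟨0, 1, 0, 0, by norm_num, by norm_num, by norm_num, by norm_num, by norm_num, by simp⟩
    · exact ⟨0, 0, 1, 0, by norm_num, by norm_num, by norm_num, by norm_num, by norm_num, by simp⟩
    · exact ⟨0, 0, 0, 1, by norm_num, by norm_num, by norm_num, by norm_num, by norm_num, by simp⟩
  · rintro ⟨α, β, γ, ε, h1, h2, h3, h4, h5, h6⟩
    have hc := convex_convexHull ℝ ({p, q, r, s} : Set (Euc 3))
    have hm : ∀ y ∈ ({p, q, r, s} : Set (Euc 3)), y ∈ convexHull ℝ {p, q, r, s} :=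
      fun y hy => subset_convexHull ℝ _ hy
    have hsum := hc.sum_mem (t := Finset.univ) (w := ![α, β, γ, ε]) (z := ![p, q, r, s])
      (by intro i _; fin_cases i <;> simpa) (by simpa [Fin.sum_univ_four] using h5)
      (by intro i _; fin_cases i <;> exact hm _ (by simp))
    convert hsum using 1
    ext i
    simp [Fin.sum_univ_four, h6]

/-- The volume of the convex hull of the origin and the standard basis. -/
def cornerVolume : ENNReal :=
  volume (convexHull ℝ {(0 : Euc 3), !₂[1, 0, 0], !₂[0, 1, 0], !₂[0, 0, 1]})

theorem volume_convexHull_four (p q r s : Euc 3) :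
    volume (convexHull ℝ {p, q, r, s}) = ENNReal.ofReal |(Matrix.of fun i j : Fin 3 =>
      ![q i - p i, r i - p i, s i - p i] j).det| * cornerVolume := by
  set D : Mat 3 := Matrix.of fun i j : Fin 3 => ![q i - p i, r i - p i, s i - p i] j with hD
  have himg : convexHull ℝ {p, q, r, s} = (fun y => p + y) ''
      (Matrix.toEuclideanLin D '' convexHull ℝ
        {(0 : Euc 3), !₂[1, 0, 0], !₂[0, 1, 0], !₂[0, 0, 1]}) := by
    rw [LinearMap.image_convexHull]
    have h := (AffineEquiv.constVAdd ℝ (Euc 3) p).toAffineMap.image_convexHull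
      (Matrix.toEuclideanLin D '' {(0 : Euc 3), !₂[1, 0, 0], !₂[0, 1, 0], !₂[0, 0, 1]})
    have h' : ∀ S : Set (Euc 3), ((AffineEquiv.constVAdd ℝ (Euc 3) p).toAffineMap : Euc 3 → Euc 3) ''
        S
      = (fun y => p + y) '' S := fun S => rfl
    rw [h', h'] at h
    rw [h]
    simp only [image_insert_eq, image_singleton, map_zero, add_zero]
    congr
    · ext i; fin_cases i <;> simp [hD]
    · ext i; fin_cases i <;> simp [hD]
    · ext i; fin_cases i <;> simp [hD]
  have hdet : LinearMap.det (Matrix.toEuclideanLin D) = D.det := by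
    change LinearMap.det (Matrix.toLpLin 2 2 D) = D.det
    rw [Matrix.toLpLin_eq_toLin, LinearMap.det_toLin]
  rw [himg, image_add_left, measure_preimage_add, Measure.addHaar_image_linearMap, hdet,
    cornerVolume]

theorem volume_hyperplane (α β γ c : ℝ) (h : α ≠ 0 ∨ β ≠ 0 ∨ γ ≠ 0) :
    volume {x : Euc 3 | α * x 0 + β * x 1 + γ * x 2 = c} = 0 := by
  let f : Euc 3 →ₗ[ℝ] ℝ := α • EuclideanSpace.projₗ 0 + β • EuclideanSpace.projₗ 1
    + γ • EuclideanSpace.projₗ 2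
  have hf : ∀ x, f x = α * x 0 + β * x 1 + γ * x 2 := fun x => by simp [f]
  by_cases hc : ∃ x₀ : Euc 3, f x₀ = c
  · obtain ⟨x₀, hx₀⟩ := hc
    have hker : volume (LinearMap.ker f : Set (Euc 3)) = 0 := by
      refine Measure.addHaar_submodule volume _ fun htop => ?_
      have h0 : ∀ x, f x = 0 := fun x => by
        have : x ∈ LinearMap.ker f := htop ▸ Submodule.mem_top
        simpa using this
      have e0 := h0 !₂[1, 0, 0]
      have e1 := h0 !₂[0, 1, 0]
      have e2 := h0 !₂[0, 0, 1]
      rw [hf] at e0 e1 e2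
      simp at e0 e1 e2
      tauto
    have hset : {x : Euc 3 | α * x 0 + β * x 1 + γ * x 2 = c}
        = (fun y => -x₀ + y) ⁻¹' (LinearMap.ker f : Set (Euc 3)) := by
      ext x
      simp only [mem_ofPred_eq, mem_preimage, SetLike.mem_coe, LinearMap.mem_ker, map_add, map_neg,
        hx₀, ← hf]
      constructor <;> intro h <;> linarith
    rw [hset, measure_preimage_add, hker]
  · have : {x : Euc 3 | α * x 0 + β * x 1 + γ * x 2 = c} = ∅ := by
      ext x
      simp only [mem_ofPred_eq, mem_empty_iff_false, iff_false, ← hf]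
      exact fun h => hc ⟨x, h⟩
    rw [this, measure_empty]

theorem volume_abs_hyperplane (α β γ c : ℝ) (h : α ≠ 0 ∨ β ≠ 0 ∨ γ ≠ 0) :
    volume {x : Euc 3 | α * |x 0| + β * |x 1| + γ * |x 2| = c} = 0 := by
  have hsub : {x : Euc 3 | α * |x 0| + β * |x 1| + γ * |x 2| = c} ⊆
      ⋃ σ : SignType × SignType × SignType,
        {x : Euc 3 | σ.1 ≠ 0 ∧ σ.2.1 ≠ 0 ∧ σ.2.2 ≠ 0 ∧
          (α * σ.1) * x 0 + (β * σ.2.1) * x 1 + (γ * σ.2.2) * x 2 = c} := by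
    intro x hx
    have key : ∀ t : ℝ, ∃ σ : SignType, σ ≠ 0 ∧ |t| = σ * t := fun t => by
      rcases abs_choice t with h | h
      · exact ⟨1, by decide, by simpa using h⟩
      · exact ⟨-1, by decide, by simpa using h⟩
    obtain ⟨σ₀, h0, k0⟩ := key (x 0)
    obtain ⟨σ₁, h1, k1⟩ := key (x 1)
    obtain ⟨σ₂, h2, k2⟩ := key (x 2)
    simp only [mem_ofPred_eq, k0, k1, k2] at hx
    refine mem_iUnion.2 ⟨(σ₀, σ₁, σ₂), h0, h1, h2, ?_⟩
    simpa only [mul_assoc] using hx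
  refine measure_mono_null hsub (measure_iUnion_null fun σ => ?_)
  by_cases hσ : σ.1 ≠ 0 ∧ σ.2.1 ≠ 0 ∧ σ.2.2 ≠ 0
  · refine measure_mono_null (fun x hx => hx.2.2.2)
      (volume_hyperplane (α * σ.1) (β * σ.2.1) (γ * σ.2.2) c ?_)
    have hne : ∀ τ : SignType, τ ≠ 0 → ((τ : SignType) : ℝ) ≠ 0 := fun τ hτ => by
      cases τ <;> simp_all
    rcases h with h | h | h
    · exact Or.inl (mul_ne_zero h (hne _ hσ.1))
    · exact Or.inr (Or.inl (mul_ne_zero h (hne _ hσ.2.1)))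
    · exact Or.inr (Or.inr (mul_ne_zero h (hne _ hσ.2.2)))
  · exact measure_mono_null (fun x hx => hσ ⟨hx.1, hx.2.1, hx.2.2.1⟩) measure_empty

end Simplices

section Model

/-- The sign `±1` encoded by a Boolean. -/
def boolSign (b : Bool) : ℝ := if b then 1 else -1

theorem abs_boolSign (b : Bool) : |boolSign b| = 1 := by cases b <;> simp [boolSign]

theorem boolSign_mul_self (b : Bool) : boolSign b * boolSign b = 1 := by
  cases b <;> simp [boolSign]

theorem boolSign_true : boolSign true = 1 := rfl

theorem boolSign_false : boolSign false = -1 := rfl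

theorem boolSign_not (b : Bool) : boolSign (!b) = -boolSign b := by cases b <;> simp [boolSign]

theorem abs_boolSign_mul (b : Bool) {t : ℝ} (ht : 0 ≤ t) : |boolSign b * t| = t := by
  rw [abs_mul, abs_boolSign, one_mul, abs_of_nonneg ht]

theorem exists_boolSign_mul_abs (t : ℝ) : ∃ b, t = boolSign b * |t| := by
  rcases le_total 0 t with h | h
  · exact ⟨true, by simp [boolSign, abs_of_nonneg h]⟩
  · exact ⟨false, by simp [boolSign, abs_of_nonpos h]⟩

/-- Labels of the twenty simplices: eight touching the faces of the diamond, then four touching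
`±e₁`, four touching `±e₂`, and four in the central block. -/
abbrev Piece := (Bool × Bool × Bool) ⊕ (Bool × Bool) ⊕ (Bool × Bool) ⊕ (Bool × Bool)

variable (μ δ : ℝ)

/-- The four interior vertices of the triangulation. -/
def innerVertex (s t : Bool) : Euc 3 :=
  !₂[boolSign s * δ, boolSign t * (μ * (1 - δ) * δ), 0]

/-- The four vertices of each simplex. -/
def pieceVertex : Piece → Fin 4 → Euc 3
  | .inl (s, t, u) => ![!₂[boolSign s, 0, 0], !₂[0, boolSign t * δ, 0], !₂[0, 0, boolSign u],
      innerVertex μ δ s t]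
  | .inr (.inl (s, u)) => ![!₂[boolSign s, 0, 0], !₂[0, 0, boolSign u],
      innerVertex μ δ s true, innerVertex μ δ s false]
  | .inr (.inr (.inl (t, u))) => ![!₂[0, boolSign t * δ, 0], !₂[0, 0, boolSign u],
      innerVertex μ δ true t, innerVertex μ δ false t]
  | .inr (.inr (.inr (k, u))) => ![!₂[0, 0, boolSign u], innerVertex μ δ true true,
      innerVertex μ δ false false, innerVertex μ δ k (!k)]

/-- The simplices of the triangulation. -/
def piece (i : Piece) : Set (Euc 3) :=
  convexHull ℝ {pieceVertex μ δ i 0, pieceVertex μ δ i 1, pieceVertex μ δ i 2,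
    pieceVertex μ δ i 3}

/-- The defining inequalities of the simplices. -/
def InPiece : Piece → Euc 3 → Prop
  | .inl (s, t, u), x => |x 0| = boolSign s * x 0 ∧ |x 1| = boolSign t * x 1 ∧
      |x 2| = boolSign u * x 2 ∧ |x 0| + |x 1| / δ ≤ 1 - |x 2| ∧
      μ * (1 - |x 2| - |x 0|) ≤ |x 1| / δ ∧
      δ * (1 - |x 2| - |x 1| / δ) ≤ |x 0| * (1 - μ * (1 - δ))
  | .inr (.inl (s, u)), x => |x 0| = boolSign s * x 0 ∧ |x 2| = boolSign u * x 2 ∧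
      δ * (1 - |x 2|) ≤ |x 0| ∧ |x 1| / δ ≤ μ * (1 - |x 2| - |x 0|)
  | .inr (.inr (.inl (t, u))), x => |x 1| = boolSign t * x 1 ∧ |x 2| = boolSign u * x 2 ∧
      μ * (1 - δ) * (1 - |x 2|) ≤ |x 1| / δ ∧
      |x 0| * (1 - μ * (1 - δ)) ≤ δ * (1 - |x 2| - |x 1| / δ)
  | .inr (.inr (.inr (k, u))), x => |x 2| = boolSign u * x 2 ∧ |x 0| ≤ δ * (1 - |x 2|) ∧
      |x 1| / δ ≤ μ * (1 - δ) * (1 - |x 2|) ∧ 0 ≤ boolSign k * (μ * (1 - δ) * x 0 - x 1)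

variable {μ δ}

theorem inPiece_of_mem (hμ : 0 < μ) (hμ' : μ ≤ 1 / 2) (hδ : 0 < δ) (hδ' : δ < 1 / 2) {i : Piece}
    {x : Euc 3} (hx : x ∈ piece μ δ i) : InPiece μ δ i x := by
  obtain ⟨q, hq⟩ : ∃ q, q = μ * (1 - δ) := ⟨_, rfl⟩
  have hq0 : 0 < q := by rw [hq]; exact mul_pos hμ (by linarith)
  have hq1 : q < 1 := by rw [hq]; nlinarith
  obtain ⟨α, β, γ, ε, hα, hβ, hγ, hε, hsum, hc⟩ := mem_convexHull_four.1 hx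
  have h0 := hc 0
  have h1 := hc 1
  have h2 := hc 2
  have hsq := boolSign_mul_self
  have hδne := hδ.ne'
  rcases i with ⟨s, t, u⟩ | ⟨s, u⟩ | ⟨t, u⟩ | ⟨k, u⟩
  · simp [pieceVertex, innerVertex, ← hq] at h0 h1 h2
    have e0 : x 0 = boolSign s * (α + ε * δ) := by rw [h0]; ring
    have e1 : x 1 = boolSign t * (δ * (β + ε * q)) := by rw [h1]; ring
    have e2 : x 2 = boolSign u * γ := by rw [h2]; ring
    have a0 : |x 0| = α + ε * δ := by rw [e0, abs_boolSign_mul _ (by positivity)]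
    have a1 : |x 1| = δ * (β + ε * q) := by rw [e1, abs_boolSign_mul _ (by positivity)]
    have a2 : |x 2| = γ := by rw [e2, abs_boolSign_mul _ hγ]
    have hd : |x 1| / δ = β + ε * q := by rw [a1]; field_simp
    simp only [InPiece, hd, ← hq]
    refine ⟨?_, ?_, ?_, ?_, ?_, ?_⟩
    · rw [a0, e0, ← mul_assoc, hsq, one_mul]
    · rw [a1, e1, ← mul_assoc, hsq, one_mul]
    · rw [a2, e2, ← mul_assoc, hsq, one_mul]
    · rw [a0, a2]; nlinarith [mul_nonneg hε (by nlinarith : (0 : ℝ) ≤ 1 - q - δ)]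
    · rw [a0, a2]
      have : 1 - γ - (α + ε * δ) = β + ε * (1 - δ) := by linear_combination -hsum
      rw [this, hq]; nlinarith
    · rw [a0, a2]
      have : 1 - γ - (β + ε * q) = α + ε * (1 - q) := by linear_combination -hsum
      rw [this]
      nlinarith [mul_nonneg hα (by nlinarith : (0 : ℝ) ≤ 1 - q - δ)]
  · simp [pieceVertex, innerVertex, ← hq] at h0 h1 h2
    have e0 : x 0 = boolSign s * (α + (γ + ε) * δ) := by rw [h0]; ring
    have e1 : x 1 = δ * (q * (γ - ε)) := by rw [h1, boolSign_true, boolSign_false]; ring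
    have e2 : x 2 = boolSign u * β := by rw [h2]; ring
    have a0 : |x 0| = α + (γ + ε) * δ := by rw [e0, abs_boolSign_mul _ (by positivity)]
    have a1 : |x 1| ≤ δ * (q * (γ + ε)) := by
      rw [e1, abs_mul, abs_mul, abs_of_pos hδ, abs_of_pos hq0]
      gcongr
      rw [abs_le]; constructor <;> linarith
    have a2 : |x 2| = β := by rw [e2, abs_boolSign_mul _ hβ]
    have hd : |x 1| / δ ≤ q * (γ + ε) := by rw [div_le_iff₀ hδ]; linarith
    refine ⟨?_, ?_, ?_, ?_⟩
    · rw [a0, e0, ← mul_assoc, hsq, one_mul]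
    · rw [a2, e2, ← mul_assoc, hsq, one_mul]
    · rw [a0, a2, show 1 - β = α + (γ + ε) by linear_combination -hsum]
      nlinarith
    · refine hd.trans (le_of_eq ?_)
      rw [a0, a2, show 1 - β - (α + (γ + ε) * δ) = (γ + ε) * (1 - δ) by
        linear_combination -hsum, hq]
      ring
  · simp [pieceVertex, innerVertex, ← hq] at h0 h1 h2
    have e0 : x 0 = δ * (γ - ε) := by rw [h0, boolSign_true, boolSign_false]; ring
    have e1 : x 1 = boolSign t * (δ * (α + (γ + ε) * q)) := by rw [h1]; ring
    have e2 : x 2 = boolSign u * β := by rw [h2]; ring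
    have a0 : |x 0| ≤ δ * (γ + ε) := by
      rw [e0, abs_mul, abs_of_pos hδ]
      gcongr
      rw [abs_le]; constructor <;> linarith
    have a1 : |x 1| = δ * (α + (γ + ε) * q) := by rw [e1, abs_boolSign_mul _ (by positivity)]
    have a2 : |x 2| = β := by rw [e2, abs_boolSign_mul _ hβ]
    have hd : |x 1| / δ = α + (γ + ε) * q := by rw [a1]; field_simp
    simp only [InPiece, hd, ← hq]
    refine ⟨?_, ?_, ?_, ?_⟩
    · rw [a1, e1, ← mul_assoc, hsq, one_mul]
    · rw [a2, e2, ← mul_assoc, hsq, one_mul]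
    · rw [a2, show 1 - β = α + (γ + ε) by linear_combination -hsum]
      nlinarith
    · rw [a2, show 1 - β - (α + (γ + ε) * q) = (γ + ε) * (1 - q) by linear_combination -hsum,
        ← mul_assoc]
      gcongr
  · simp [pieceVertex, innerVertex, boolSign_not, ← hq] at h0 h1 h2
    have e0 : x 0 = δ * (β - γ + ε * boolSign k) := by rw [h0, boolSign_true, boolSign_false]; ring
    have e1 : x 1 = δ * (q * (β - γ - ε * boolSign k)) := by
      rw [h1, boolSign_true, boolSign_false]; ring
    have e2 : x 2 = boolSign u * α := by rw [h2]; ring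
    have hk : |ε * boolSign k| = ε := by rw [abs_mul, abs_boolSign, mul_one, abs_of_nonneg hε]
    obtain ⟨k1, k2⟩ := abs_le.1 hk.le
    have a2 : |x 2| = α := by rw [e2, abs_boolSign_mul _ hα]
    refine ⟨?_, ?_, ?_, ?_⟩
    · rw [a2, e2, ← mul_assoc, hsq, one_mul]
    · rw [a2, e0, abs_mul, abs_of_pos hδ]
      gcongr
      rw [abs_le]; constructor <;> linarith
    · rw [a2, e1, div_le_iff₀ hδ, abs_mul, abs_mul, abs_of_pos hδ, abs_of_pos hq0, ← hq,
        mul_comm δ]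
      gcongr
      rw [abs_le]; constructor <;> linarith
    · rw [← hq, e0, e1]
      have : boolSign k * (q * (δ * (β - γ + ε * boolSign k)) -
          δ * (q * (β - γ - ε * boolSign k))) = 2 * (q * δ * ε) := by
        linear_combination 2 * q * δ * ε * hsq k
      rw [this]; positivity

theorem mem_of_inPiece (hμ : 0 < μ) (hμ' : μ ≤ 1 / 2) (hδ : 0 < δ) (hδ' : δ < 1 / 2) {i : Piece}
    {x : Euc 3} (hx : InPiece μ δ i x) : x ∈ piece μ δ i := by
  obtain ⟨q, hq⟩ : ∃ q, q = μ * (1 - δ) := ⟨_, rfl⟩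
  have hq0 : 0 < q := by rw [hq]; exact mul_pos hμ (by linarith)
  have hq1 : q < 1 := by rw [hq]; nlinarith
  obtain ⟨b, hb⟩ : ∃ b, b = |x 1| / δ := ⟨_, rfl⟩
  have hsq := boolSign_mul_self
  have hδne := hδ.ne'
  have hqne := hq0.ne'
  have hab : |x 1| = δ * b := by rw [hb]; field_simp
  have hb0 : 0 ≤ b := by rw [hb]; positivity
  have n0 := abs_nonneg (x 0)
  have n2 := abs_nonneg (x 2)
  have expand : ∀ (s : Bool) (t : ℝ), |t| = boolSign s * t → t = boolSign s * |t| := fun s t h => by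
    rw [h, ← mul_assoc, hsq, one_mul]
  have hD : 0 < 1 - δ := by linarith
  have hQ : 0 < 1 - q := by linarith
  have hDne := hD.ne'
  have hQne := hQ.ne'
  refine mem_convexHull_four.2 ?_
  simp only [Fin.forall_fin_succ, Fin.succ_zero_eq_one,
    Fin.succ_one_eq_two, IsEmpty.forall_iff, and_true]
  rcases i with ⟨s, t, u⟩ | ⟨s, u⟩ | ⟨t, u⟩ | ⟨k, u⟩
  · obtain ⟨c0, c1, c2, c3, c4, c5⟩ := hx
    rw [← hb] at c3 c4 c5
    rw [← hq] at c5
    have d0 := expand s _ c0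
    have d1 := expand t _ c1
    have d2 := expand u _ c2
    have hE : 0 < 1 - δ - q := by rw [hq]; nlinarith
    have hEne := hE.ne'
    refine ⟨|x 0| - (1 - |x 2| - |x 0| - b) / (1 - δ - q) * δ,
      b - (1 - |x 2| - |x 0| - b) / (1 - δ - q) * q, |x 2|,
      (1 - |x 2| - |x 0| - b) / (1 - δ - q), ?_, ?_, n2, div_nonneg (by linarith) hE.le,
      ?_, ?_, ?_, ?_⟩
    · rw [sub_nonneg, div_mul_eq_mul_div, div_le_iff₀ hE]; nlinarith
    · rw [sub_nonneg, div_mul_eq_mul_div, div_le_iff₀ hE]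
      have := mul_le_mul_of_nonneg_right c4 hD.le
      rw [hq] at *; nlinarith
    · field_simp; ring
    · simp [pieceVertex, innerVertex, ← hq]
      rw [d0, abs_mul, abs_boolSign, one_mul, abs_abs]; ring
    · simp [pieceVertex, innerVertex, ← hq]
      rw [d1, hab]; ring
    · simp [pieceVertex, innerVertex, ← hq]
      rw [d2, abs_mul, abs_boolSign, one_mul, abs_abs]; ring
  · obtain ⟨c0, c2, c3, c4⟩ := hx
    rw [← hb] at c4
    have d0 := expand s _ c0
    have d2 := expand u _ c2
    have hy : |x 1 / (δ * q)| ≤ (1 - |x 2| - |x 0|) / (1 - δ) := by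
      rw [abs_div, abs_of_pos (mul_pos hδ hq0), hab, div_le_div_iff₀ (mul_pos hδ hq0) hD, hq]
      nlinarith [mul_le_mul_of_nonneg_left c4 (mul_pos hδ hD).le]
    obtain ⟨y1, y2⟩ := abs_le.1 hy
    have hB : 1 - |x 2| - (1 - |x 2| - |x 0|) / (1 - δ) = (|x 0| - δ * (1 - |x 2|)) / (1 - δ) := by
      field_simp; ring
    refine ⟨1 - |x 2| - (1 - |x 2| - |x 0|) / (1 - δ), |x 2|,
      ((1 - |x 2| - |x 0|) / (1 - δ) + x 1 / (δ * q)) / 2,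
      ((1 - |x 2| - |x 0|) / (1 - δ) - x 1 / (δ * q)) / 2, ?_, n2, by linarith, by linarith,
      by ring, ?_, ?_, ?_⟩
    · rw [hB]; exact div_nonneg (by linarith) hD.le
    · simp [pieceVertex, innerVertex, ← hq]
      nth_rewrite 1 [d0]
      field_simp
      ring
    · simp [pieceVertex, innerVertex, ← hq, boolSign]
      field_simp
      ring
    · simp [pieceVertex, innerVertex, ← hq]
      nth_rewrite 1 [d2]
      ring
  · obtain ⟨c1, c2, c3, c4⟩ := hx
    rw [← hb, ← hq] at c3 c4
    have d1 := expand t _ c1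
    have d2 := expand u _ c2
    have hy : |x 0 / δ| ≤ (1 - |x 2| - b) / (1 - q) := by
      rw [abs_div, abs_of_pos hδ, div_le_div_iff₀ hδ hQ]
      linarith
    obtain ⟨y1, y2⟩ := abs_le.1 hy
    have hB : 1 - |x 2| - (1 - |x 2| - b) / (1 - q) = (b - q * (1 - |x 2|)) / (1 - q) := by
      field_simp; ring
    refine ⟨1 - |x 2| - (1 - |x 2| - b) / (1 - q), |x 2|,
      ((1 - |x 2| - b) / (1 - q) + x 0 / δ) / 2,
      ((1 - |x 2| - b) / (1 - q) - x 0 / δ) / 2, ?_, n2, by linarith, by linarith,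
      by ring, ?_, ?_, ?_⟩
    · rw [hB]; exact div_nonneg (by linarith) hQ.le
    · simp [pieceVertex, innerVertex, ← hq, boolSign]
      field_simp
      ring
    · simp [pieceVertex, innerVertex, ← hq]
      nth_rewrite 1 [d1]
      rw [hab]
      field_simp
      ring
    · simp [pieceVertex, innerVertex, ← hq]
      nth_rewrite 1 [d2]
      ring
  · obtain ⟨c2, c3, c4, c5⟩ := hx
    rw [← hb] at c4
    rw [← hq] at c4 c5
    have d2 := expand u _ c2
    obtain ⟨X, hX⟩ : ∃ X, X = x 0 / δ := ⟨_, rfl⟩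
    obtain ⟨Y, hY⟩ : ∃ Y, Y = x 1 / (δ * q) := ⟨_, rfl⟩
    have eX : x 0 = δ * X := by rw [hX]; field_simp
    have eY : x 1 = δ * (q * Y) := by rw [hY]; field_simp
    have bX : |X| ≤ 1 - |x 2| := by rw [hX, abs_div, abs_of_pos hδ, div_le_iff₀ hδ]; linarith
    have bY : |Y| ≤ 1 - |x 2| := by
      rw [hY, abs_div, abs_of_pos (mul_pos hδ hq0), div_le_iff₀ (mul_pos hδ hq0), hab]
      nlinarith
    obtain ⟨X1, X2⟩ := abs_le.1 bX
    obtain ⟨Y1, Y2⟩ := abs_le.1 bY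
    have hXY : 0 ≤ boolSign k * (X - Y) := by
      have : boolSign k * (q * x 0 - x 1) = (q * δ) * (boolSign k * (X - Y)) := by
        rw [eX, eY]; ring
      rw [this] at c5
      exact nonneg_of_mul_nonneg_right c5 (by positivity)
    cases k
    · simp only [boolSign] at hXY
      refine ⟨|x 2|, (1 - |x 2| + X) / 2, (1 - |x 2| - Y) / 2, (Y - X) / 2, n2, by linarith,
        by linarith, ?_, by ring, ?_, ?_, ?_⟩
      · norm_num at hXY; linarith
      · simp [pieceVertex, innerVertex, ← hq, boolSign]
        rw [eX]; ring
      · simp [pieceVertex, innerVertex, ← hq, boolSign]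
        rw [eY]; ring
      · simp [pieceVertex, innerVertex, ← hq]
        nth_rewrite 1 [d2]
        ring
    · simp only [boolSign] at hXY
      refine ⟨|x 2|, (1 - |x 2| + Y) / 2, (1 - |x 2| - X) / 2, (X - Y) / 2, n2, by linarith,
        by linarith, ?_, by ring, ?_, ?_, ?_⟩
      · norm_num at hXY; linarith
      · simp [pieceVertex, innerVertex, ← hq, boolSign]
        rw [eX]; ring
      · simp [pieceVertex, innerVertex, ← hq, boolSign]
        rw [eY]; ring
      · simp [pieceVertex, innerVertex, ← hq]
        nth_rewrite 1 [d2]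
        ring

end Model

section Triangulation

variable {μ δ : ℝ}

theorem exists_inPiece (hμ : 0 < μ) (hμ' : μ ≤ 1 / 2) (hδ : 0 < δ) (hδ' : δ < 1 / 2) {x : Euc 3}
    (hx : |x 0| + |x 1| / δ ≤ 1 - |x 2|) : ∃ i, InPiece μ δ i x := by
  have key : ∀ t : ℝ, ∃ b, |t| = boolSign b * t := fun t => by
    obtain ⟨b, hb⟩ := exists_boolSign_mul_abs t
    refine ⟨b, ?_⟩
    nth_rewrite 2 [hb]
    rw [← mul_assoc, boolSign_mul_self, one_mul]
  obtain ⟨s, hs⟩ := key (x 0)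
  obtain ⟨t, ht⟩ := key (x 1)
  obtain ⟨u, hu⟩ := key (x 2)
  obtain ⟨k, hk⟩ := key (μ * (1 - δ) * x 0 - x 1)
  have hk' : 0 ≤ boolSign k * (μ * (1 - δ) * x 0 - x 1) := hk ▸ abs_nonneg _
  obtain ⟨a, ha⟩ : ∃ a, a = |x 0| := ⟨_, rfl⟩
  obtain ⟨b, hb⟩ : ∃ b, b = |x 1| / δ := ⟨_, rfl⟩
  obtain ⟨h, hh⟩ : ∃ h, h = 1 - |x 2| := ⟨_, rfl⟩
  rcases le_total b (μ * (h - a)) with h1 | h1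
  · rcases le_total (δ * h) a with h2 | h2
    · refine ⟨.inr (.inl (s, u)), hs, hu, ?_, ?_⟩
      · rwa [← hh, ← ha]
      · rwa [← hh, ← ha, ← hb]
    · rcases le_total b (μ * (1 - δ) * h) with h3 | h3
      · refine ⟨.inr (.inr (.inr (k, u))), hu, ?_, ?_, hk'⟩
        · rwa [← hh, ← ha]
        · rwa [← hh, ← hb]
      · refine ⟨.inr (.inr (.inl (t, u))), ht, hu, ?_, ?_⟩
        · rwa [← hh, ← hb]
        · rw [← hh, ← hb, ← ha]
          nlinarith [mul_nonneg (by linarith : (0 : ℝ) ≤ 1 - μ) (sub_nonneg.2 h2)]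
  · rcases le_total (δ * (h - b)) (a * (1 - μ * (1 - δ))) with h2 | h2
    · refine ⟨.inl (s, t, u), hs, ht, hu, hx, ?_, ?_⟩
      · rwa [← hh, ← ha, ← hb]
      · rwa [← hh, ← ha, ← hb]
    · refine ⟨.inr (.inr (.inl (t, u))), ht, hu, ?_, ?_⟩
      · rw [← hh, ← hb]
        have h4 : (1 - μ) * a ≤ (1 - μ) * (δ * h) := by nlinarith
        have h5 : a ≤ δ * h := le_of_mul_le_mul_left h4 (by linarith)
        nlinarith
      · rwa [← hh, ← hb, ← ha]

theorem abs_add_le_of_mem_baseDiamond (hδ : 0 < δ) {x : Euc 3} (hx : x ∈ baseDiamond 3 δ) :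
    |x 0| + |x 1| / δ ≤ 1 - |x 2| := by
  let S : Set (Euc 3) := {x | |x 0| + |x 1| / δ ≤ 1 - |x 2|}
  have hS : Convex ℝ S := by
    intro x hx y hy a b ha hb hab
    simp only [S, mem_ofPred_eq, PiLp.add_apply, PiLp.smul_apply, smul_eq_mul] at hx hy ⊢
    have tri : ∀ i, |a * x i + b * y i| ≤ a * |x i| + b * |y i| := fun i => by
      refine (abs_add_le _ _).trans_eq ?_
      rw [abs_mul, abs_mul, abs_of_nonneg ha, abs_of_nonneg hb]
    have t1 : |a * x 1 + b * y 1| / δ ≤ a * (|x 1| / δ) + b * (|y 1| / δ) := by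
      rw [← mul_div_assoc, ← mul_div_assoc, ← add_div]
      gcongr
      exact tri 1
    nlinarith [tri 0, tri 2]
  refine convexHull_min ?_ hS hx
  rintro v ⟨i, rfl | rfl⟩ <;> fin_cases i <;>
    simp [S, abs_of_pos hδ, hδ.ne']

theorem mem_baseDiamond_axes (b : Bool) (δ : ℝ) :
    (!₂[boolSign b, 0, 0] : Euc 3) ∈ baseDiamond 3 δ ∧
    (!₂[0, boolSign b * δ, 0] : Euc 3) ∈ baseDiamond 3 δ ∧
    (!₂[0, 0, boolSign b] : Euc 3) ∈ baseDiamond 3 δ := by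
  refine ⟨subset_convexHull ℝ _ ⟨0, ?_⟩, subset_convexHull ℝ _ ⟨1, ?_⟩,
    subset_convexHull ℝ _ ⟨2, ?_⟩⟩ <;> cases b
  · right; ext i; fin_cases i <;> simp [boolSign]
  · left; ext i; fin_cases i <;> simp [boolSign]
  · right; ext i; fin_cases i <;> simp [boolSign]
  · left; ext i; fin_cases i <;> simp [boolSign]
  · right; ext i; fin_cases i <;> simp [boolSign]
  · left; ext i; fin_cases i <;> simp [boolSign]

theorem innerVertex_mem_baseDiamond (hμ : 0 < μ) (hμ' : μ ≤ 1 / 2) (hδ : 0 < δ) (hδ' : δ < 1 / 2)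
    (s t : Bool) : innerVertex μ δ s t ∈ baseDiamond 3 δ := by
  have hq0 : 0 ≤ μ * (1 - δ) := mul_nonneg hμ.le (by linarith)
  have hq1 : δ + μ * (1 - δ) ≤ 1 := by nlinarith
  refine convexHull_min (t := baseDiamond 3 δ) ?_ (convex_convexHull ℝ _)
    (mem_convexHull_four.2 ⟨δ, μ * (1 - δ), (1 - δ - μ * (1 - δ)) / 2,
      (1 - δ - μ * (1 - δ)) / 2, hδ.le, hq0, by linarith, by linarith, by ring, ?_⟩ :
      innerVertex μ δ s t ∈ convexHull ℝ {!₂[boolSign s, 0, 0], !₂[0, boolSign t * δ, 0],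
        !₂[0, 0, boolSign true], !₂[0, 0, boolSign false]})
  · rintro y (rfl | rfl | rfl | rfl)
    exacts [(mem_baseDiamond_axes s δ).1, (mem_baseDiamond_axes t δ).2.1,
      (mem_baseDiamond_axes true δ).2.2, (mem_baseDiamond_axes false δ).2.2]
  · intro i
    fin_cases i <;> simp [innerVertex, boolSign_true, boolSign_false] <;> ring

theorem pieceVertex_mem_baseDiamond (hμ : 0 < μ) (hμ' : μ ≤ 1 / 2) (hδ : 0 < δ) (hδ' : δ < 1 / 2)
    (i : Piece) (j : Fin 4) : pieceVertex μ δ i j ∈ baseDiamond 3 δ := by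
  have hP := innerVertex_mem_baseDiamond hμ hμ' hδ hδ'
  have hE := fun b => mem_baseDiamond_axes b δ
  rcases i with ⟨s, t, u⟩ | ⟨s, u⟩ | ⟨t, u⟩ | ⟨k, u⟩ <;> fin_cases j
  exacts [(hE s).1, (hE t).2.1, (hE u).2.2, hP _ _, (hE s).1, (hE u).2.2, hP _ _, hP _ _,
    (hE t).2.1, (hE u).2.2, hP _ _, hP _ _, (hE u).2.2, hP _ _, hP _ _, hP _ _]

theorem baseDiamond_eq_iUnion (hμ : 0 < μ) (hμ' : μ ≤ 1 / 2) (hδ : 0 < δ) (hδ' : δ < 1 / 2) :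
    baseDiamond 3 δ = ⋃ i, piece μ δ i := by
  refine Subset.antisymm (fun x hx => ?_) (iUnion_subset fun i => ?_)
  · obtain ⟨i, hi⟩ := exists_inPiece hμ hμ' hδ hδ' (abs_add_le_of_mem_baseDiamond hδ hx)
    exact mem_iUnion.2 ⟨i, mem_of_inPiece hμ hμ' hδ hδ' hi⟩
  · refine convexHull_min ?_ (convex_convexHull ℝ _)
    have h := pieceVertex_mem_baseDiamond hμ hμ' hδ hδ' i
    rintro y (rfl | rfl | rfl | rfl)
    exacts [h 0, h 1, h 2, h 3]

theorem abs_add_eq_of_mem_frontier (hμ : 0 < μ) (hμ' : μ ≤ 1 / 2) (hδ : 0 < δ) (hδ' : δ < 1 / 2)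
    {x : Euc 3} (hx : x ∈ frontier (baseDiamond 3 δ)) : |x 0| + |x 1| / δ = 1 - |x 2| := by
  have h : baseDiamond 3 δ = {x : Euc 3 | |x 0| + |x 1| / δ ≤ 1 - |x 2|} := by
    refine Subset.antisymm (fun x hx => abs_add_le_of_mem_baseDiamond hδ hx) fun x hx => ?_
    obtain ⟨i, hi⟩ := exists_inPiece hμ hμ' hδ hδ' hx
    rw [baseDiamond_eq_iUnion hμ hμ' hδ hδ']
    exact mem_iUnion.2 ⟨i, mem_of_inPiece hμ hμ' hδ hδ' hi⟩
  rw [h] at hx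
  exact frontier_le_subset_eq (by fun_prop) (by fun_prop) hx

theorem volume_piece_inter (hμ : 0 < μ) (hμ' : μ ≤ 1 / 2) (hδ : 0 < δ) (hδ' : δ < 1 / 2)
    {i j : Piece} (hij : i ≠ j) : volume (piece μ δ i ∩ piece μ δ j) = 0 := by
  have hq0 : 0 < μ * (1 - δ) := mul_pos hμ (by linarith)
  have hq1 : μ * (1 - δ) < 1 := by nlinarith
  let N : Set (Euc 3) := {x | x 0 = 0} ∪ {x | x 1 = 0} ∪ {x | x 2 = 0} ∪
    {x | μ * (1 - δ) * x 0 - x 1 = 0} ∪ {x | |x 0| = δ * (1 - |x 2|)} ∪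
    {x | |x 1| / δ = μ * (1 - δ) * (1 - |x 2|)} ∪
    {x | |x 1| / δ = μ * (1 - |x 2| - |x 0|)} ∪
    {x | |x 0| * (1 - μ * (1 - δ)) = δ * (1 - |x 2| - |x 1| / δ)}
  have hN : volume N = 0 := by
    have hpl : ∀ (S : Set (Euc 3)) (α β γ c : ℝ), (α ≠ 0 ∨ β ≠ 0 ∨ γ ≠ 0) →
        (∀ x ∈ S, α * x 0 + β * x 1 + γ * x 2 = c) → volume S = 0 := fun S α β γ c h hS =>
      measure_mono_null hS (volume_hyperplane α β γ c h)
    have hab : ∀ (S : Set (Euc 3)) (α β γ c : ℝ), (α ≠ 0 ∨ β ≠ 0 ∨ γ ≠ 0) →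
        (∀ x ∈ S, α * |x 0| + β * |x 1| + γ * |x 2| = c) → volume S = 0 := fun S α β γ c h hS =>
      measure_mono_null hS (volume_abs_hyperplane α β γ c h)
    refine measure_union_null (measure_union_null (measure_union_null (measure_union_null
      (measure_union_null (measure_union_null (measure_union_null ?_ ?_) ?_) ?_) ?_) ?_) ?_) ?_
    · exact hpl _ 1 0 0 0 (by simp) (by simp)
    · exact hpl _ 0 1 0 0 (by simp) (by simp)
    · exact hpl _ 0 0 1 0 (by simp) (by simp)
    · refine hpl _ (μ * (1 - δ)) (-1) 0 0 (by simp) fun x hx => ?_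
      simp only [mem_ofPred_eq] at hx
      linear_combination hx
    · refine hab _ 1 0 δ δ (by simp) fun x hx => ?_
      simp only [mem_ofPred_eq] at hx
      linear_combination hx
    · refine hab _ 0 (1 / δ) (μ * (1 - δ)) (μ * (1 - δ)) (Or.inr (Or.inl (by positivity)))
        fun x hx => ?_
      simp only [mem_ofPred_eq] at hx
      linear_combination hx
    · refine hab _ μ (1 / δ) μ μ (Or.inl hμ.ne') fun x hx => ?_
      simp only [mem_ofPred_eq] at hx
      linear_combination hx
    · refine hab _ (1 - μ * (1 - δ)) (δ * (1 / δ)) δ δ (Or.inl (by linarith)) fun x hx => ?_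
      simp only [mem_ofPred_eq] at hx
      linear_combination hx
  refine measure_mono_null (fun x hx => ?_) hN
  have hi := inPiece_of_mem hμ hμ' hδ hδ' hx.1
  have hj := inPiece_of_mem hμ hμ' hδ hδ' hx.2
  by_contra hxN
  simp only [N, mem_union, mem_ofPred_eq, not_or] at hxN
  obtain ⟨⟨⟨⟨⟨⟨⟨n0, n1⟩, n2⟩, n3⟩, n4⟩, n5⟩, n6⟩, n7⟩ := hxN
  have hsame : ∀ {t : ℝ} {s s' : Bool}, t ≠ 0 → |t| = boolSign s * t → |t| = boolSign s' * t →
      s = s' := fun {t s s'} ht h h' => by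
    have := mul_right_cancel₀ ht (h.symm.trans h')
    revert this
    cases s <;> cases s' <;> norm_num [boolSign]
  have hk : ∀ {t : ℝ} {s s' : Bool}, t ≠ 0 → 0 ≤ boolSign s * t → 0 ≤ boolSign s' * t →
      s = s' := fun {t s s'} ht h h' => by
    refine hsame ht ?_ ?_
    · rw [← abs_of_nonneg h, abs_mul, abs_boolSign, one_mul]
    · rw [← abs_of_nonneg h', abs_mul, abs_boolSign, one_mul]
  have hle : |x 0| ≤ δ * (1 - |x 2|) →
      μ * (1 - δ) * (1 - |x 2|) ≤ μ * (1 - |x 2| - |x 0|) := fun h => by nlinarith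
  have hge : δ * (1 - |x 2|) ≤ |x 0| →
      μ * (1 - |x 2| - |x 0|) ≤ μ * (1 - δ) * (1 - |x 2|) := fun h => by nlinarith
  rcases i with ⟨s, t, u⟩ | ⟨s, u⟩ | ⟨t, u⟩ | ⟨k, u⟩ <;>
    rcases j with ⟨s', t', u'⟩ | ⟨s', u'⟩ | ⟨t', u'⟩ | ⟨k', u'⟩ <;>
    simp only [InPiece] at hi hj
  · exact hij (by rw [hsame n0 hi.1 hj.1, hsame n1 hi.2.1 hj.2.1, hsame n2 hi.2.2.1 hj.2.2.1])
  · exact n6 (le_antisymm hj.2.2.2 hi.2.2.2.2.1)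
  · exact n7 (le_antisymm hj.2.2.2 hi.2.2.2.2.2)
  · exact n5 (le_antisymm hj.2.2.1 ((hle hj.2.1).trans hi.2.2.2.2.1))
  · exact n6 (le_antisymm hi.2.2.2 hj.2.2.2.2.1)
  · exact hij (by rw [hsame n0 hi.1 hj.1, hsame n2 hi.2.1 hj.2.1])
  · exact n5 (le_antisymm (hi.2.2.2.trans (hge hi.2.2.1)) hj.2.2.1)
  · exact n4 (le_antisymm hj.2.1 hi.2.2.1)
  · exact n7 (le_antisymm hi.2.2.2 hj.2.2.2.2.2)
  · exact n5 (le_antisymm (hj.2.2.2.trans (hge hj.2.2.1)) hi.2.2.1)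
  · exact hij (by rw [hsame n1 hi.1 hj.1, hsame n2 hi.2.1 hj.2.1])
  · exact n5 (le_antisymm hj.2.2.1 hi.2.2.1)
  · exact n5 (le_antisymm hi.2.2.1 ((hle hi.2.1).trans hj.2.2.2.2.1))
  · exact n4 (le_antisymm hi.2.1 hj.2.2.1)
  · exact n5 (le_antisymm hi.2.2.1 hj.2.2.1)
  · exact hij (by rw [hk n3 hi.2.2.2 hj.2.2.2, hsame n2 hi.1 hj.1])

/-- The normalised volume of each simplex. -/
def pieceWeight (μ δ : ℝ) : Piece → ℝ
  | .inl _ => δ * (1 - δ) * (1 - μ)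
  | .inr (.inl _) => 2 * δ * (μ * (1 - δ)) * (1 - δ)
  | .inr (.inr (.inl _)) => 2 * δ * δ * (1 - μ * (1 - δ))
  | .inr (.inr (.inr _)) => 4 * δ * δ * (μ * (1 - δ))

theorem pieceWeight_nonneg (hμ : 0 < μ) (hμ' : μ ≤ 1 / 2) (hδ : 0 < δ) (hδ' : δ < 1 / 2)
    (i : Piece) : 0 ≤ pieceWeight μ δ i := by
  have h1 : 0 ≤ 1 - δ := by linarith
  have h2 : 0 ≤ 1 - μ := by linarith
  have h3 : 0 ≤ 1 - μ * (1 - δ) := by nlinarith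
  rcases i with _ | _ | _ | _ <;> simp only [pieceWeight] <;> positivity

theorem volume_piece (hμ : 0 < μ) (hμ' : μ ≤ 1 / 2) (hδ : 0 < δ) (hδ' : δ < 1 / 2) (i : Piece) :
    volume (piece μ δ i) = ENNReal.ofReal (pieceWeight μ δ i) * cornerVolume := by
  rw [piece, volume_convexHull_four]
  congr 2
  rw [← abs_of_nonneg (pieceWeight_nonneg hμ hμ' hδ hδ' i), abs_eq_abs, Matrix.det_fin_three]
  rcases i with ⟨_ | _, _ | _, _ | _⟩ | ⟨_ | _, _ | _⟩ | ⟨_ | _, _ | _⟩ | ⟨_ | _, _ | _⟩ <;>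
    simp [pieceVertex, innerVertex, pieceWeight, boolSign_true, boolSign_false] <;>
    first | (left; ring1) | (right; ring1)

/-- The simplices in which the gradient is close to the first phase. -/
def IsInner : Piece → Prop
  | .inl _ => False
  | .inr (.inl _) => True
  | .inr (.inr (.inl _)) => False
  | .inr (.inr (.inr _)) => True

theorem measurableSet_piece (μ δ : ℝ) (i : Piece) : MeasurableSet (piece μ δ i) := by
  have hf : ({pieceVertex μ δ i 0, pieceVertex μ δ i 1, pieceVertex μ δ i 2,
    pieceVertex μ δ i 3} : Set (Euc 3)).Finite := by simp
  exact (hf.isCompact_convexHull (𝕜 := ℝ)).isClosed.measurableSet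

theorem volume_iUnion_piece (hμ : 0 < μ) (hμ' : μ ≤ 1 / 2) (hδ : 0 < δ) (hδ' : δ < 1 / 2)
    (p : Piece → Prop) [DecidablePred p] : volume (⋃ i, ⋃ _ : p i, piece μ δ i) =
      ENNReal.ofReal (∑ i, if p i then pieceWeight μ δ i else 0) * cornerVolume := by
  have h : ∀ i, volume (⋃ _ : p i, piece μ δ i) =
      ENNReal.ofReal (if p i then pieceWeight μ δ i else 0) * cornerVolume := fun i => by
    by_cases hp : p i
    · simp [hp, volume_piece hμ hμ' hδ hδ']
    · simp [hp]
  rw [measure_iUnion₀]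
  · rw [tsum_fintype, ENNReal.ofReal_sum_of_nonneg, Finset.sum_mul]
    · exact Finset.sum_congr rfl fun i _ => h i
    · intro i _
      split_ifs
      exacts [pieceWeight_nonneg hμ hμ' hδ hδ' i, le_rfl]
  · intro i j hij
    exact measure_mono_null (inter_subset_inter (iUnion_subset fun _ => Subset.rfl)
      (iUnion_subset fun _ => Subset.rfl)) (volume_piece_inter hμ hμ' hδ hδ' hij)
  · exact fun i => (MeasurableSet.iUnion fun _ => measurableSet_piece μ δ i).nullMeasurableSet

theorem volume_baseDiamond (hμ : 0 < μ) (hμ' : μ ≤ 1 / 2) (hδ : 0 < δ) (hδ' : δ < 1 / 2) :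
    volume (baseDiamond 3 δ) = ENNReal.ofReal (8 * δ) * cornerVolume := by
  have h := volume_iUnion_piece hμ hμ' hδ hδ' (fun _ => True)
  simp only [iUnion_true, if_true] at h
  rw [baseDiamond_eq_iUnion hμ hμ' hδ hδ', h]
  congr 2
  simp [pieceWeight, Fintype.sum_sum_type]
  ring

open Classical in
theorem volume_iUnion_inner (hμ : 0 < μ) (hμ' : μ ≤ 1 / 2) (hδ : 0 < δ) (hδ' : δ < 1 / 2) :
    volume (⋃ i, ⋃ _ : IsInner i, piece μ δ i) =
      ENNReal.ofReal (μ * (1 - δ ^ 2)) * volume (baseDiamond 3 δ) := by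
  rw [volume_iUnion_piece hμ hμ' hδ hδ', volume_baseDiamond hμ hμ' hδ hδ', ← mul_assoc,
    ← ENNReal.ofReal_mul (mul_nonneg hμ.le (by nlinarith))]
  congr 2
  simp [pieceWeight, Fintype.sum_sum_type, IsInner]
  ring

open Classical in
theorem volume_iUnion_outer (hμ : 0 < μ) (hμ' : μ ≤ 1 / 2) (hδ : 0 < δ) (hδ' : δ < 1 / 2) :
    volume (⋃ i, ⋃ _ : ¬ IsInner i, piece μ δ i) =
      ENNReal.ofReal (1 - μ * (1 - δ ^ 2)) * volume (baseDiamond 3 δ) := by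
  rw [volume_iUnion_piece hμ hμ' hδ hδ', volume_baseDiamond hμ hμ' hδ hδ', ← mul_assoc,
    ← ENNReal.ofReal_mul (by nlinarith [sq_nonneg δ])]
  congr 2
  simp [pieceWeight, Fintype.sum_sum_type, IsInner]
  ring

end Triangulation

section ModelMap

/-- Truncation of `t` to the interval `[-g, g]`. -/
def clamp (g t : ℝ) : ℝ := max (-g) (min t g)

theorem clamp_of_abs_le {g t : ℝ} (h : |t| ≤ g) : clamp g t = t := by
  obtain ⟨h1, h2⟩ := abs_le.1 h
  rw [clamp, min_eq_left h2, max_eq_right h1]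

theorem clamp_of_le_boolSign_mul {g t : ℝ} (b : Bool) (hg : 0 ≤ g) (h : g ≤ boolSign b * t) :
    clamp g t = boolSign b * g := by
  cases b
  · simp only [boolSign_false] at h ⊢
    rw [clamp, max_eq_left ((min_le_left _ _).trans (by linarith))]
    ring
  · simp only [boolSign_true, one_mul] at h ⊢
    rw [clamp, min_eq_right h, max_eq_right (by linarith)]

theorem abs_clamp_le {g t : ℝ} (hg : 0 ≤ g) : |clamp g t| ≤ g :=
  abs_le.2 ⟨le_max_left _ _, max_le (by linarith) (min_le_right _ _)⟩

theorem matVec_apply {n : ℕ} (A : Mat n) (x : Euc n) (i : Fin n) :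
    matVec A x i = ∑ j, A i j * x j := by
  simp [matVec, matCLM, Matrix.mulVec, dotProduct]

variable (μ δ : ℝ)

/-- The slope of the model map in the simplices touching `±e₂`. -/
def capSlope : ℝ := μ * (1 - μ) * (1 - δ) / (1 - μ * (1 - δ))

/-- The model map on the diamond. -/
def modelMap (x : Euc 3) : Euc 3 :=
  !₂[clamp (min (μ * δ * (1 - |x 2| - |x 0| - |x 1| / δ))
        (capSlope μ δ * δ * (1 - |x 2| - |x 1| / δ))) ((1 - μ) * x 1),
    -clamp (min (μ * δ ^ 2 * (1 - |x 2| - |x 0| - |x 1| / δ))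
        (μ * (1 - μ) * δ ^ 2 * (1 - |x 2| - |x 0|))) (μ * (1 - μ) * (1 - δ) * δ * x 0), 0]

/-- The gradient of the model map on each simplex. -/
def pieceGrad : Piece → Mat 3
  | .inl (s, t, u) =>
      !![-(boolSign s * boolSign t * (μ * δ)), -μ, -(boolSign t * boolSign u * (μ * δ));
        μ * δ ^ 2, boolSign s * boolSign t * (μ * δ), boolSign s * boolSign u * (μ * δ ^ 2);
        0, 0, 0]
  | .inr (.inl (s, u)) =>
      !![0, 1 - μ, 0;
        μ * (1 - μ) * δ ^ 2, 0, boolSign s * boolSign u * (μ * (1 - μ) * δ ^ 2);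
        0, 0, 0]
  | .inr (.inr (.inl (t, u))) =>
      !![0, -capSlope μ δ, -(boolSign t * boolSign u * (capSlope μ δ * δ));
        -(μ * (1 - μ) * (1 - δ) * δ), 0, 0;
        0, 0, 0]
  | .inr (.inr (.inr _)) => !![0, 1 - μ, 0; -(μ * (1 - μ) * (1 - δ) * δ), 0, 0; 0, 0, 0]

/-- The constant part of the model map on each simplex. -/
def pieceOffset : Piece → Euc 3
  | .inl (s, t, _) => !₂[boolSign t * (μ * δ), -(boolSign s * (μ * δ ^ 2)), 0]
  | .inr (.inl (s, _)) => !₂[0, -(boolSign s * (μ * (1 - μ) * δ ^ 2)), 0]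
  | .inr (.inr (.inl (t, _))) => !₂[boolSign t * (capSlope μ δ * δ), 0, 0]
  | .inr (.inr (.inr _)) => 0

theorem continuous_modelMap : Continuous (modelMap μ δ) := by
  unfold modelMap clamp
  refine (PiLp.continuous_toLp 2 _).comp (continuous_pi fun i => ?_)
  fin_cases i <;> simp <;> fun_prop

variable {μ δ}

theorem capSlope_mul (hμ : 0 < μ) (hμ' : μ ≤ 1 / 2) (hδ : 0 < δ) :
    capSlope μ δ * (1 - μ * (1 - δ)) = μ * (1 - μ) * (1 - δ) :=
  div_mul_cancel₀ _ (by nlinarith)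

theorem capSlope_nonneg (hμ : 0 < μ) (hμ' : μ ≤ 1 / 2) (hδ : 0 < δ) (hδ' : δ < 1 / 2) :
    0 ≤ capSlope μ δ :=
  div_nonneg (mul_nonneg (mul_nonneg hμ.le (by linarith)) (by linarith)) (by nlinarith)

theorem capSlope_le (hμ : 0 < μ) (hμ' : μ ≤ 1 / 2) (hδ : 0 < δ) :
    capSlope μ δ ≤ μ := by
  rw [capSlope, div_le_iff₀ (by nlinarith)]
  nlinarith [mul_pos hμ hδ]

theorem sub_capSlope_le (hμ : 0 < μ) (hμ' : μ ≤ 1 / 2) (hδ : 0 < δ) :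
    μ - capSlope μ δ ≤ 2 * (μ * δ) := by
  have h : 0 < 1 - μ * (1 - δ) := by nlinarith
  have : μ - capSlope μ δ = μ * δ / (1 - μ * (1 - δ)) := by
    rw [capSlope]; field_simp; ring
  rw [this, div_le_iff₀ h]
  nlinarith [mul_pos hμ hδ]

theorem modelMap_of_inPiece (hμ : 0 < μ) (hμ' : μ ≤ 1 / 2) (hδ : 0 < δ) (hδ' : δ < 1 / 2)
    {i : Piece} {x : Euc 3} (hx : InPiece μ δ i x) :
    modelMap μ δ x = matVec (pieceGrad μ δ i) x + pieceOffset μ δ i := by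
  obtain ⟨b, hb⟩ : ∃ b, b = |x 1| / δ := ⟨_, rfl⟩
  obtain ⟨a, ha⟩ : ∃ a, a = |x 0| := ⟨_, rfl⟩
  obtain ⟨h, hh⟩ : ∃ h, h = 1 - |x 2| := ⟨_, rfl⟩
  obtain ⟨κ, hκ⟩ : ∃ κ, κ = capSlope μ δ := ⟨_, rfl⟩
  have hκ0 : 0 ≤ κ := hκ ▸ capSlope_nonneg hμ hμ' hδ hδ'
  have hκm : κ * (1 - μ * (1 - δ)) = μ * (1 - μ) * (1 - δ) := hκ ▸ capSlope_mul hμ hμ' hδ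
  have hδne := hδ.ne'
  have hab : |x 1| = δ * b := by rw [hb]; field_simp
  have hb0 : 0 ≤ b := by rw [hb]; positivity
  have ha0 : 0 ≤ a := ha ▸ abs_nonneg (x 0)
  have hμ1 : 0 < 1 - μ := by linarith
  have hD : 0 < 1 - δ := by linarith
  have hq : 0 < 1 - μ * (1 - δ) := by nlinarith
  have hφ : 0 < μ * (1 - μ) * (1 - δ) := by positivity
  have hsq := boolSign_mul_self
  have hcap : (1 - μ * (1 - δ)) * (κ * (h - b) - μ * (h - a - b)) =
      μ * (a * (1 - μ * (1 - δ)) - δ * (h - b)) := by linear_combination (h - b) * hκm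
  have hcap' : (1 - μ * (1 - δ)) * ((1 - μ) * b - κ * (h - b)) =
      (1 - μ) * (b - μ * (1 - δ) * h) := by linear_combination (b - h) * hκm
  suffices h : clamp (min (μ * δ * (h - a - b)) (κ * δ * (h - b)))
        ((1 - μ) * x 1) = matVec (pieceGrad μ δ i) x 0 + pieceOffset μ δ i 0 ∧
      -clamp (min (μ * δ ^ 2 * (h - a - b)) (μ * (1 - μ) * δ ^ 2 * (h - a)))
        (μ * (1 - μ) * (1 - δ) * δ * x 0) =
        matVec (pieceGrad μ δ i) x 1 + pieceOffset μ δ i 1 by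
    rw [hb, hκ, ha, hh] at h
    ext j
    fin_cases j
    · simpa [modelMap] using h.1
    · simpa [modelMap] using h.2
    · rcases i with ⟨s, t, u⟩ | ⟨s, u⟩ | ⟨t, u⟩ | ⟨k, u⟩ <;>
        simp [modelMap, matVec_apply, pieceGrad, pieceOffset, Fin.sum_univ_three]
  have habs1 : |(1 - μ) * x 1| = (1 - μ) * (δ * b) := by rw [abs_mul, abs_of_pos hμ1, hab]
  have habs0 : |μ * (1 - μ) * (1 - δ) * δ * x 0| = μ * (1 - μ) * (1 - δ) * δ * a := by
    rw [abs_mul, abs_of_pos (by positivity), ha]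
  have le_outer (hc : μ * (h - a) ≤ b) : δ * (μ * (h - a - b)) ≤ δ * ((1 - μ) * b) :=
    mul_le_mul_of_nonneg_left (by linarith) hδ.le
  have ge_outer (hc : b ≤ μ * (h - a)) : δ * ((1 - μ) * b) ≤ δ * (μ * (h - a - b)) :=
    mul_le_mul_of_nonneg_left (by linarith) hδ.le
  have le_cap (hc : δ * (h - b) ≤ a * (1 - μ * (1 - δ))) :
      δ * (μ * (h - a - b)) ≤ δ * (κ * (h - b)) :=
    mul_le_mul_of_nonneg_left (sub_nonneg.1 (nonneg_of_mul_nonneg_right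
      (hcap ▸ mul_nonneg hμ.le (by linarith)) hq)) hδ.le
  have ge_cap (hc : a * (1 - μ * (1 - δ)) ≤ δ * (h - b)) :
      δ * (κ * (h - b)) ≤ δ * (μ * (h - a - b)) :=
    mul_le_mul_of_nonneg_left (sub_nonpos.1 (nonpos_of_mul_nonpos_right
      (hcap ▸ mul_nonpos_of_nonneg_of_nonpos hμ.le (by linarith)) hq)) hδ.le
  have cap_le (hc : μ * (1 - δ) * h ≤ b) : δ * (κ * (h - b)) ≤ δ * ((1 - μ) * b) :=
    mul_le_mul_of_nonneg_left (sub_nonneg.1 (nonneg_of_mul_nonneg_right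
      (hcap' ▸ mul_nonneg hμ1.le (by linarith)) hq)) hδ.le
  have cap_ge (hc : b ≤ μ * (1 - δ) * h) : δ * ((1 - μ) * b) ≤ δ * (κ * (h - b)) :=
    mul_le_mul_of_nonneg_left (sub_nonpos.1 (nonpos_of_mul_nonpos_right
      (hcap' ▸ mul_nonpos_of_nonneg_of_nonpos hμ1.le (by linarith)) hq)) hδ.le
  have le_slope (hc : δ * (h - b) ≤ a * (1 - μ * (1 - δ))) :
      μ * δ * (δ * (h - a - b)) ≤ μ * δ * ((1 - μ) * (1 - δ) * a) :=
    mul_le_mul_of_nonneg_left (by linarith) (by positivity)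
  have ge_slope (hc : a * (1 - μ * (1 - δ)) ≤ δ * (h - b)) :
      μ * δ * ((1 - μ) * (1 - δ) * a) ≤ μ * δ * (δ * (h - a - b)) :=
    mul_le_mul_of_nonneg_left (by linarith) (by positivity)
  have le_side (hc : δ * h ≤ a) :
      μ * (1 - μ) * δ * (δ * (h - a)) ≤ μ * (1 - μ) * δ * ((1 - δ) * a) :=
    mul_le_mul_of_nonneg_left (by linarith) (by positivity)
  have ge_side (hc : a ≤ δ * h) :
      μ * (1 - μ) * δ * ((1 - δ) * a) ≤ μ * (1 - μ) * δ * (δ * (h - a)) :=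
    mul_le_mul_of_nonneg_left (by linarith) (by positivity)
  have le_outer' (hc : μ * (h - a) ≤ b) :
      μ * δ ^ 2 * (h - a - b) ≤ μ * δ ^ 2 * ((1 - μ) * (h - a)) :=
    mul_le_mul_of_nonneg_left (by linarith) (by positivity)
  have ge_outer' (hc : b ≤ μ * (h - a)) :
      μ * δ ^ 2 * ((1 - μ) * (h - a)) ≤ μ * δ ^ 2 * (h - a - b) :=
    mul_le_mul_of_nonneg_left (by linarith) (by positivity)
  rcases i with ⟨s, t, u⟩ | ⟨s, u⟩ | ⟨t, u⟩ | ⟨k, u⟩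
  · obtain ⟨c0, c1, c2, c3, c4, c5⟩ := hx
    rw [← hb, ← hh, ← ha] at c3 c4 c5
    have hm : 0 ≤ h - a - b := by linarith
    rw [min_eq_left (by linarith [le_cap c5]), min_eq_left (by linarith [le_outer' c4]),
      clamp_of_le_boolSign_mul t (by positivity) ?_,
      clamp_of_le_boolSign_mul s (by positivity) ?_]
    · constructor
      · simp [matVec_apply, pieceGrad, pieceOffset, Fin.sum_univ_three]
        rw [hb, hh, ha, c0, c1, c2]
        field_simp
        linear_combination (-x 1) * hsq t
      · simp [matVec_apply, pieceGrad, pieceOffset, Fin.sum_univ_three]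
        rw [hb, hh, ha, c0, c1, c2]
        field_simp
        linear_combination (δ * x 0) * hsq s
    · rw [mul_left_comm, ← c0, ← ha]
      linarith [le_slope c5]
    · rw [mul_left_comm, ← c1, hab]
      linarith [le_outer c4]
  · obtain ⟨c0, c2, c3, c4⟩ := hx
    rw [← hb, ← hh, ← ha] at c4
    rw [← hh, ← ha] at c3
    have hha : 0 ≤ h - a := nonneg_of_mul_nonneg_right (hb0.trans c4) hμ
    rw [clamp_of_abs_le ?_, min_eq_right (by linarith [ge_outer' c4]),
      clamp_of_le_boolSign_mul s (by positivity) ?_]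
    · constructor
      · simp [matVec_apply, pieceGrad, pieceOffset, Fin.sum_univ_three]
      · simp [matVec_apply, pieceGrad, pieceOffset, Fin.sum_univ_three]
        rw [hh, ha, c0, c2]
        linear_combination (μ * (1 - μ) * δ ^ 2 * x 0) * hsq s
    · rw [mul_left_comm, ← c0, ← ha]
      linarith [le_side c3]
    · rw [habs1]
      refine le_min (by linarith [ge_outer c4]) ?_
      have := mul_le_mul_of_nonneg_left c3 hμ.le
      linarith [cap_ge (by linarith)]
  · obtain ⟨c1, c2, c3, c4⟩ := hx
    rw [← hb, ← hh] at c3 c4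
    rw [← ha] at c4
    have hhb : 0 ≤ h - b := nonneg_of_mul_nonneg_right ((mul_nonneg ha0 hq.le).trans c4) hδ
    rw [min_eq_right (by linarith [ge_cap c4]),
      clamp_of_le_boolSign_mul t (by positivity) ?_, clamp_of_abs_le ?_]
    · constructor
      · simp [matVec_apply, pieceGrad, pieceOffset, Fin.sum_univ_three, ← hκ]
        rw [hb, hh, c1, c2]
        field_simp
        linear_combination (-κ * x 1) * hsq t
      · simp [matVec_apply, pieceGrad, pieceOffset, Fin.sum_univ_three]
    · rw [habs0]
      have h1 : a ≤ δ * h := by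
        have := mul_le_mul_of_nonneg_left c3 hδ.le
        exact le_of_mul_le_mul_right (by linarith) hq
      exact le_min (by linarith [ge_slope c4]) (by linarith [ge_side h1])
    · rw [mul_left_comm, ← c1, hab]
      linarith [cap_le c3]
  · obtain ⟨c2, c3, c4, c5⟩ := hx
    rw [← hb, ← hh] at c4
    rw [← hh, ← ha] at c3
    have h1 : b ≤ μ * (h - a) := by
      have := mul_le_mul_of_nonneg_left c3 hμ.le
      linarith
    have h2 : a * (1 - μ * (1 - δ)) ≤ δ * (h - b) := by
      have := mul_le_mul_of_nonneg_right c3 hq.le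
      have := mul_le_mul_of_nonneg_left c4 hδ.le
      linarith
    rw [clamp_of_abs_le ?_, clamp_of_abs_le ?_]
    · simp [matVec_apply, pieceGrad, pieceOffset, Fin.sum_univ_three]
    · rw [habs0]
      exact le_min (by linarith [ge_slope h2]) (by linarith [ge_side c3])
    · rw [habs1]
      exact le_min (by linarith [ge_outer h1]) (by linarith [cap_ge c4])

end ModelMap

section ModelBounds

variable {μ δ : ℝ}

theorem modelMap_eq_zero (hμ : 0 < μ) (hμ' : μ ≤ 1 / 2) (hδ : 0 < δ) (hδ' : δ < 1 / 2)
    {x : Euc 3} (hx : |x 0| + |x 1| / δ = 1 - |x 2|) : modelMap μ δ x = 0 := by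
  have h0 := abs_nonneg (x 0)
  have h1 : 0 ≤ |x 1| / δ := by positivity
  have hκ := capSlope_nonneg hμ hμ' hδ hδ'
  have hz : 1 - |x 2| - |x 0| - |x 1| / δ = 0 := by linarith
  have hμ1 : 0 ≤ 1 - μ := by linarith
  have hclamp (t : ℝ) : clamp 0 t = 0 := abs_nonpos_iff.1 (abs_clamp_le le_rfl)
  have e1 : 0 ≤ capSlope μ δ * δ * (1 - |x 2| - |x 1| / δ) :=
    mul_nonneg (mul_nonneg hκ hδ.le) (by linarith)
  have e2 : 0 ≤ μ * (1 - μ) * δ ^ 2 * (1 - |x 2| - |x 0|) :=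
    mul_nonneg (by positivity) (by linarith)
  rw [modelMap, hz, mul_zero, mul_zero, min_eq_left e1, min_eq_left e2, hclamp, hclamp]
  ext j
  fin_cases j <;> simp

theorem norm_modelMap_le (hμ : 0 < μ) (hμ' : μ ≤ 1 / 2) (hδ : 0 < δ) (hδ' : δ < 1 / 2)
    {x : Euc 3} (hx : |x 0| + |x 1| / δ ≤ 1 - |x 2|) : ‖modelMap μ δ x‖ ≤ 2 * (μ * δ) := by
  have h0 := abs_nonneg (x 0)
  have h2 := abs_nonneg (x 2)
  have h1 : 0 ≤ |x 1| / δ := by positivity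
  have hκ := capSlope_nonneg hμ hμ' hδ hδ'
  have hμ1 : 0 ≤ 1 - μ := by linarith
  have hμδ : 0 < μ * δ := by positivity
  have hm : 0 ≤ 1 - |x 2| - |x 0| - |x 1| / δ := by linarith
  have e1 : 0 ≤ capSlope μ δ * δ * (1 - |x 2| - |x 1| / δ) :=
    mul_nonneg (mul_nonneg hκ hδ.le) (by linarith)
  have e2 : 0 ≤ μ * (1 - μ) * δ ^ 2 * (1 - |x 2| - |x 0|) :=
    mul_nonneg (by positivity) (by linarith)
  have b0 : |modelMap μ δ x 0| ≤ μ * δ :=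
    (abs_clamp_le (le_min (by positivity) e1)).trans <|
      (min_le_left _ _).trans (mul_le_of_le_one_right hμδ.le (by linarith))
  have b1 : |modelMap μ δ x 1| ≤ μ * δ := by
    have : modelMap μ δ x 1 = -clamp (min (μ * δ ^ 2 * (1 - |x 2| - |x 0| - |x 1| / δ))
        (μ * (1 - μ) * δ ^ 2 * (1 - |x 2| - |x 0|))) (μ * (1 - μ) * (1 - δ) * δ * x 0) := rfl
    rw [this, abs_neg]
    refine (abs_clamp_le (le_min (by positivity) e2)).trans ((min_le_left _ _).trans ?_)
    refine (mul_le_of_le_one_right (by positivity) (by linarith)).trans ?_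
    nlinarith
  rw [EuclideanSpace.norm_eq, Real.sqrt_le_iff, Fin.sum_univ_three]
  refine ⟨by positivity, ?_⟩
  have b2 : modelMap μ δ x 2 = 0 := rfl
  rw [b2, norm_zero, Real.norm_eq_abs, Real.norm_eq_abs]
  nlinarith [pow_le_pow_left₀ (abs_nonneg _) b0 2, pow_le_pow_left₀ (abs_nonneg _) b1 2]

theorem trace_pieceGrad (μ δ : ℝ) (i : Piece) : (pieceGrad μ δ i).trace = 0 := by
  rcases i with ⟨s, t, u⟩ | ⟨s, u⟩ | ⟨t, u⟩ | ⟨k, u⟩ <;>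
    simp [pieceGrad, Matrix.trace, Fin.sum_univ_three]

theorem frobNorm_pieceGrad_sub_le (hμ : 0 < μ) (hμ' : μ ≤ 1 / 2) (hδ : 0 < δ) (hδ' : δ < 1 / 2)
    {i : Piece} (hi : IsInner i) :
    frobNorm (pieceGrad μ δ i - Matrix.single 0 1 (1 - μ)) ≤ 3 * (μ * δ) := by
  rw [frobNorm, Real.sqrt_le_iff]
  refine ⟨by positivity, ?_⟩
  have hμ1 : 0 ≤ 1 - μ := by linarith
  have e1 : (μ * (1 - μ) * (1 - δ) * δ) ^ 2 ≤ (μ * δ) ^ 2 := by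
    refine pow_le_pow_left₀ (mul_nonneg (mul_nonneg (by positivity) (by linarith)) hδ.le) ?_ 2
    have : (1 - μ) * (1 - δ) ≤ 1 := by nlinarith
    nlinarith [mul_pos hμ hδ]
  have e2 : (μ * (1 - μ) * δ ^ 2) ^ 2 ≤ (μ * δ) ^ 2 := by
    refine pow_le_pow_left₀ (by positivity) ?_ 2
    have : (1 - μ) * δ ≤ 1 := by nlinarith
    nlinarith [mul_pos hμ hδ]
  have hsq (b : Bool) : boolSign b ^ 2 = 1 := by rw [sq, boolSign_mul_self]
  rcases i with ⟨s, t, u⟩ | ⟨s, u⟩ | ⟨t, u⟩ | ⟨k, u⟩ <;> simp [IsInner] at hi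
  · simp [pieceGrad, Fin.sum_univ_three, Matrix.single_apply]
    rw [mul_pow (_ * _) (_ * _ * _), mul_pow (boolSign _), hsq, hsq]
    linarith [sq_nonneg (μ * δ)]
  · simp [pieceGrad, Fin.sum_univ_three, Matrix.single_apply]
    linarith [sq_nonneg (μ * δ)]

theorem frobNorm_pieceGrad_add_le (hμ : 0 < μ) (hμ' : μ ≤ 1 / 2) (hδ : 0 < δ) (hδ' : δ < 1 / 2)
    {i : Piece} (hi : ¬IsInner i) :
    frobNorm (pieceGrad μ δ i + Matrix.single 0 1 μ) ≤ 3 * (μ * δ) := by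
  rw [frobNorm, Real.sqrt_le_iff]
  refine ⟨by positivity, ?_⟩
  have hμ1 : 0 ≤ 1 - μ := by linarith
  have hκ := capSlope_nonneg hμ hμ' hδ hδ'
  have hκμ := capSlope_le hμ hμ' hδ
  have e1 : (μ * (1 - μ) * (1 - δ) * δ) ^ 2 ≤ (μ * δ) ^ 2 := by
    refine pow_le_pow_left₀ (mul_nonneg (mul_nonneg (by positivity) (by linarith)) hδ.le) ?_ 2
    have : (1 - μ) * (1 - δ) ≤ 1 := by nlinarith
    nlinarith [mul_pos hμ hδ]
  have e2 : (μ * δ ^ 2) ^ 2 ≤ (μ * δ) ^ 2 := by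
    refine pow_le_pow_left₀ (by positivity) ?_ 2
    nlinarith [mul_pos hμ hδ]
  have e3 : (capSlope μ δ * δ) ^ 2 ≤ (μ * δ) ^ 2 := by gcongr
  have e4 : (-capSlope μ δ + μ) ^ 2 ≤ (2 * (μ * δ)) ^ 2 :=
    pow_le_pow_left₀ (by linarith) (by linarith [sub_capSlope_le hμ hμ' hδ]) 2
  have hsq (b : Bool) : boolSign b ^ 2 = 1 := by rw [sq, boolSign_mul_self]
  rcases i with ⟨s, t, u⟩ | ⟨s, u⟩ | ⟨t, u⟩ | ⟨k, u⟩ <;> simp [IsInner] at hi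
  · simp [pieceGrad, Fin.sum_univ_three, Matrix.single_apply]
    simp only [mul_pow (_ * _) (μ * _), mul_pow (boolSign _), hsq]
    linarith [sq_nonneg (μ * δ)]
  · simp [pieceGrad, Fin.sum_univ_three, Matrix.single_apply]
    simp only [mul_pow (_ * _) (capSlope _ _ * _), mul_pow (boolSign _), hsq]
    linarith [sq_nonneg (μ * δ)]

theorem frobNorm_lt_of_isInner {i : Piece} (hi : IsInner i) :
    frobNorm (pieceGrad μ δ i - Matrix.single 0 1 (1 - μ)) <
      frobNorm (pieceGrad μ δ i + Matrix.single 0 1 μ) := by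
  refine Real.sqrt_lt_sqrt (by positivity) ?_
  rcases i with ⟨s, t, u⟩ | ⟨s, u⟩ | ⟨t, u⟩ | ⟨k, u⟩ <;> simp [IsInner] at hi <;>
    simp [pieceGrad, Fin.sum_univ_three, Matrix.single_apply]

theorem frobNorm_lt_of_not_isInner (hμ : 0 < μ) (hμ' : μ ≤ 1 / 2) (hδ : 0 < δ) (hδ' : δ < 1 / 2)
    {i : Piece} (hi : ¬IsInner i) :
    frobNorm (pieceGrad μ δ i + Matrix.single 0 1 μ) <
      frobNorm (pieceGrad μ δ i - Matrix.single 0 1 (1 - μ)) := by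
  refine Real.sqrt_lt_sqrt (by positivity) ?_
  rcases i with ⟨s, t, u⟩ | ⟨s, u⟩ | ⟨t, u⟩ | ⟨k, u⟩ <;> simp [IsInner] at hi <;>
    simp [pieceGrad, Fin.sum_univ_three, Matrix.single_apply]
  · nlinarith
  · nlinarith [sub_capSlope_le hμ hμ' hδ, mul_pos hμ hδ]

theorem card_range_pieceGrad_le (μ δ : ℝ) :
    ∃ V : Finset (Mat 3), V.card ≤ 10 ∧ ∀ i, pieceGrad μ δ i ∈ V := by
  classical
  let r : (Bool × Bool) ⊕ Bool ⊕ Bool ⊕ Unit → Piece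
    | .inl (t, u) => .inl (true, t, u)
    | .inr (.inl u) => .inr (.inl (true, u))
    | .inr (.inr (.inl u)) => .inr (.inr (.inl (true, u)))
    | .inr (.inr (.inr _)) => .inr (.inr (.inr (true, true)))
  refine ⟨Finset.univ.image fun j => pieceGrad μ δ (r j), Finset.card_image_le.trans (by simp),
    fun i => ?_⟩
  suffices ∃ j, pieceGrad μ δ (r j) = pieceGrad μ δ i by
    obtain ⟨j, hj⟩ := this
    exact Finset.mem_image.2 ⟨j, Finset.mem_univ _, hj⟩
  rcases i with ⟨s, t, u⟩ | ⟨s, u⟩ | ⟨t, u⟩ | ⟨k, u⟩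
  · cases s
    · exact ⟨.inl (!t, !u), by simp [r, pieceGrad, boolSign_not, boolSign_true, boolSign_false]⟩
    · exact ⟨.inl (t, u), rfl⟩
  · cases s
    · exact ⟨.inr (.inl !u), by simp [r, pieceGrad, boolSign_not, boolSign_true, boolSign_false]⟩
    · exact ⟨.inr (.inl u), rfl⟩
  · cases t
    · exact ⟨.inr (.inr (.inl !u)),
        by simp [r, pieceGrad, boolSign_not, boolSign_true, boolSign_false]⟩
    · exact ⟨.inr (.inr (.inl u)), rfl⟩
  · exact ⟨.inr (.inr (.inr ())), rfl⟩

end ModelBounds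

section Rotation

theorem matVec_matVec {n : ℕ} (A B : Mat n) (x : Euc n) :
    matVec A (matVec B x) = matVec (A * B) x := by
  ext i
  simp [matVec, matCLM, Matrix.mulVec_mulVec]

theorem matVec_one {n : ℕ} (x : Euc n) : matVec 1 x = x := by
  ext i
  simp [matVec, matCLM]

theorem matVec_add_mat {n : ℕ} (A B : Mat n) (x : Euc n) :
    matVec (A + B) x = matVec A x + matVec B x := by
  ext i
  simp [matVec, matCLM]

theorem matVec_smul_mat {n : ℕ} (c : ℝ) (A : Mat n) (x : Euc n) :
    matVec (c • A) x = c • matVec A x := by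
  ext i
  simp [matVec, matCLM]

theorem frobNorm_eq_sqrt_trace {n : ℕ} (A : Mat n) : frobNorm A = √(Aᵀ * A).trace := by
  rw [frobNorm, Finset.sum_comm]
  simp [Matrix.trace, Matrix.mul_apply, sq]

theorem frobNorm_smul_conj {n : ℕ} {Q : Mat n} (hQ : Qᵀ * Q = 1) {c : ℝ} (hc : 0 ≤ c)
    (X : Mat n) : frobNorm (c • (Q * X * Qᵀ)) = c * frobNorm X := by
  have h : (c • (Q * X * Qᵀ))ᵀ * (c • (Q * X * Qᵀ)) = c ^ 2 • (Q * (Xᵀ * X) * Qᵀ) := by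
    simp only [transpose_smul, transpose_mul, transpose_transpose,
      Matrix.smul_mul, Matrix.mul_smul, smul_smul]
    rw [show Q * (Xᵀ * Qᵀ) * (Q * X * Qᵀ) = Q * (Xᵀ * (Qᵀ * Q) * X) * Qᵀ by
      simp only [Matrix.mul_assoc], hQ, Matrix.mul_one, sq]
  rw [frobNorm_eq_sqrt_trace, h, trace_smul, trace_mul_comm, ← Matrix.mul_assoc, hQ,
    Matrix.one_mul, smul_eq_mul, Real.sqrt_mul (sq_nonneg c), Real.sqrt_sq hc,
    frobNorm_eq_sqrt_trace]

theorem norm_matVec {n : ℕ} {Q : Mat n} (hQ : Qᵀ * Q = 1) (x : Euc n) : ‖matVec Q x‖ = ‖x‖ := by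
  have h : Matrix.mulVec Q x ⬝ᵥ Matrix.mulVec Q x = x ⬝ᵥ x := by
    rw [dotProduct_mulVec, vecMul_mulVec, hQ, vecMul_one]
  rw [EuclideanSpace.norm_eq, EuclideanSpace.norm_eq]
  congr 1
  simpa [dotProduct, matVec, matCLM, sq] using h

/-- A rotation taking `e₁ ⊗ e₂` to a multiple of a given trace-free rank-one matrix. -/
theorem exists_rotation {a nv : Euc 3} (ha : a ≠ 0) (hnv : ‖nv‖ = 1)
    (h : (vecMulVec (fun i => a i) (fun j => nv j)).trace = 0) :
    ∃ Q : Mat 3, Qᵀ * Q = 1 ∧ Q.det = 1 ∧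
      vecMulVec (fun i => a i) (fun j => nv j) = ‖a‖ • (Q * Matrix.single 0 1 1 * Qᵀ) := by
  have ha' : ‖a‖ ≠ 0 := norm_ne_zero_iff.2 ha
  obtain ⟨f, hf⟩ : ∃ f : Fin 3 → ℝ, ∀ i, a i = ‖a‖ * f i :=
    ⟨fun i => a i / ‖a‖, fun i => by field_simp⟩
  have hff : f 0 ^ 2 + f 1 ^ 2 + f 2 ^ 2 = 1 := by
    have h1 : ‖a‖ ^ 2 = a 0 ^ 2 + a 1 ^ 2 + a 2 ^ 2 := by
      simp [EuclideanSpace.norm_sq_eq, Fin.sum_univ_three]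
    rw [hf 0, hf 1, hf 2] at h1
    exact mul_left_cancel₀ (pow_ne_zero 2 ha') (by linear_combination -h1)
  have hnn : nv 0 ^ 2 + nv 1 ^ 2 + nv 2 ^ 2 = 1 := by
    have h1 : ‖nv‖ ^ 2 = nv 0 ^ 2 + nv 1 ^ 2 + nv 2 ^ 2 := by
      simp [EuclideanSpace.norm_sq_eq, Fin.sum_univ_three]
    rw [← h1, hnv, one_pow]
  have hfn : f 0 * nv 0 + f 1 * nv 1 + f 2 * nv 2 = 0 := by
    simp only [Matrix.trace, Fin.sum_univ_three, diag_apply, vecMulVec_apply] at h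
    rw [hf 0, hf 1, hf 2] at h
    exact mul_left_cancel₀ ha' (by linear_combination h)
  have hcc : (f 1 * nv 2 - f 2 * nv 1) ^ 2 + (f 2 * nv 0 - f 0 * nv 2) ^ 2 +
      (f 0 * nv 1 - f 1 * nv 0) ^ 2 = 1 := by
    linear_combination (nv 0 ^ 2 + nv 1 ^ 2 + nv 2 ^ 2) * hff + hnn -
      (f 0 * nv 0 + f 1 * nv 1 + f 2 * nv 2) * hfn
  refine ⟨!![f 0, nv 0, f 1 * nv 2 - f 2 * nv 1; f 1, nv 1, f 2 * nv 0 - f 0 * nv 2;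
    f 2, nv 2, f 0 * nv 1 - f 1 * nv 0], ?_, ?_, ?_⟩
  · ext i j
    fin_cases i <;> fin_cases j <;> simp [Matrix.mul_apply, Fin.sum_univ_three]
    · linear_combination hff
    · linear_combination hfn
    · ring
    · linear_combination hfn
    · linear_combination hnn
    · ring
    · ring
    · ring
    · linear_combination hcc
  · rw [det_fin_three]
    simp
    linear_combination hcc
  · have hE (Q : Mat 3) (i j : Fin 3) :
        (Q * Matrix.single 0 1 1 * Qᵀ : Mat 3) i j = Q i 0 * Q j 1 := by
      simp [Matrix.mul_apply, Fin.sum_univ_three, Matrix.single_apply]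
    ext i j
    rw [vecMulVec_apply, hf, Matrix.smul_apply, hE, smul_eq_mul, ← mul_assoc]
    fin_cases i <;> fin_cases j <;> rfl

end Rotation

section Rotated

variable (Q M : Mat 3) (ρ μ δ : ℝ)

/-- The model map rotated by `Q`, scaled by `ρ` and added to the linear map `M`. -/
def rotatedMap (x : Euc 3) : Euc 3 :=
  matVec M x + ρ • matVec Q (modelMap μ δ (matVec Qᵀ x))

/-- The rotated simplices. -/
def rotatedPiece (i : Piece) : Set (Euc 3) := matVec Q '' piece μ δ i

/-- The gradient of the rotated map on each simplex. -/
def rotatedGrad (i : Piece) : Mat 3 := M + ρ • (Q * pieceGrad μ δ i * Qᵀ)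

theorem continuous_matVec {n : ℕ} (A : Mat n) : Continuous (matVec A) := (matCLM A).continuous

theorem continuous_rotatedMap : Continuous (rotatedMap Q M ρ μ δ) :=
  (continuous_matVec M).add <| ((continuous_matVec Q).comp <|
    (continuous_modelMap μ δ).comp (continuous_matVec Qᵀ)).const_smul ρ

theorem rotatedPiece_eq (i : Piece) : rotatedPiece Q μ δ i =
    convexHull ℝ {matVec Q (pieceVertex μ δ i 0), matVec Q (pieceVertex μ δ i 1),
      matVec Q (pieceVertex μ δ i 2), matVec Q (pieceVertex μ δ i 3)} := by
  have h := (matCLM Q).toLinearMap.image_convexHull {pieceVertex μ δ i 0,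
    pieceVertex μ δ i 1, pieceVertex μ δ i 2, pieceVertex μ δ i 3}
  simp only [image_insert_eq, image_singleton] at h
  exact h

variable {Q} {μ δ}

theorem volume_image_matVec (hdet : Q.det = 1) (S : Set (Euc 3)) :
    volume (matVec Q '' S) = volume S := by
  have h : LinearMap.det (Matrix.toEuclideanLin Q) = Q.det := by
    change LinearMap.det (Matrix.toLpLin 2 2 Q) = Q.det
    rw [Matrix.toLpLin_eq_toLin, LinearMap.det_toLin]
  have h' := Measure.addHaar_image_linearMap volume (Matrix.toEuclideanLin Q) S
  rwa [h, hdet, abs_one, ENNReal.ofReal_one, one_mul] at h'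

theorem matVec_transpose_matVec (hQ : Qᵀ * Q = 1) (x : Euc 3) : matVec Qᵀ (matVec Q x) = x := by
  rw [matVec_matVec, hQ, matVec_one]

/-- An orthogonal matrix as a homeomorphism. -/
def rotationHomeomorph (Q : Mat 3) (hQ : Qᵀ * Q = 1) : Euc 3 ≃ₜ Euc 3 where
  toFun := matVec Q
  invFun := matVec Qᵀ
  left_inv := matVec_transpose_matVec hQ
  right_inv x := by rw [matVec_matVec, mul_eq_one_comm.1 hQ, matVec_one]
  continuous_toFun := continuous_matVec Q
  continuous_invFun := continuous_matVec Qᵀ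

theorem rotatedMap_sub (hQ : Qᵀ * Q = 1) (x : Euc 3) :
    rotatedMap Q M ρ μ δ (matVec Q x) - matVec M (matVec Q x) =
      ρ • matVec Q (modelMap μ δ x) := by
  rw [rotatedMap, matVec_transpose_matVec hQ, add_sub_cancel_left]

theorem rotatedMap_of_mem (hμ : 0 < μ) (hμ' : μ ≤ 1 / 2) (hδ : 0 < δ)
    (hδ' : δ < 1 / 2) (hQ : Qᵀ * Q = 1) {i : Piece} {x : Euc 3}
    (hx : x ∈ rotatedPiece Q μ δ i) : rotatedMap Q M ρ μ δ x =
      matVec (rotatedGrad Q M ρ μ δ i) x + ρ • matVec Q (pieceOffset μ δ i) := by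
  obtain ⟨y, hy, rfl⟩ := hx
  rw [rotatedMap, rotatedGrad, matVec_transpose_matVec hQ, matVec_add_mat, matVec_smul_mat,
    modelMap_of_inPiece hμ hμ' hδ hδ' (inPiece_of_mem hμ hμ' hδ hδ' hy), matVec_matVec _ Q y,
    matVec_matVec (_ * Qᵀ), Matrix.mul_assoc, hQ, Matrix.mul_one, ← matVec_matVec Q]
  have h := map_add (matCLM Q) (matVec (pieceGrad μ δ i) y) (pieceOffset μ δ i)
  rw [← matVec, ← matVec, ← matVec] at h
  rw [h, smul_add, add_assoc]

theorem hasFDerivAt_rotatedMap (hμ : 0 < μ) (hμ' : μ ≤ 1 / 2) (hδ : 0 < δ)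
    (hδ' : δ < 1 / 2) (hQ : Qᵀ * Q = 1) {i : Piece} {x : Euc 3}
    (hx : x ∈ interior (rotatedPiece Q μ δ i)) :
    HasFDerivAt (rotatedMap Q M ρ μ δ) (matCLM (rotatedGrad Q M ρ μ δ i)) x := by
  refine ((matCLM (rotatedGrad Q M ρ μ δ i)).hasFDerivAt.add_const
    (ρ • matVec Q (pieceOffset μ δ i))).congr_of_eventuallyEq ?_
  filter_upwards [mem_interior_iff_mem_nhds.1 hx] with y hy
  exact rotatedMap_of_mem M ρ hμ hμ' hδ hδ' hQ hy

theorem rotatedMap_of_mem_frontier (hμ : 0 < μ) (hμ' : μ ≤ 1 / 2) (hδ : 0 < δ)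
    (hδ' : δ < 1 / 2) (hQ : Qᵀ * Q = 1) {x : Euc 3}
    (hx : x ∈ frontier (matVec Q '' baseDiamond 3 δ)) : rotatedMap Q M ρ μ δ x = matVec M x := by
  have h := (rotationHomeomorph Q hQ).image_frontier (baseDiamond 3 δ)
  change matVec Q '' _ = frontier (matVec Q '' _) at h
  rw [← h] at hx
  obtain ⟨y, hy, rfl⟩ := hx
  rw [← sub_eq_zero, rotatedMap_sub M ρ hQ,
    modelMap_eq_zero hμ hμ' hδ hδ' (abs_add_eq_of_mem_frontier hμ hμ' hδ hδ' hy)]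
  simp [matVec]

theorem norm_rotatedMap_sub_le (hμ : 0 < μ) (hμ' : μ ≤ 1 / 2) (hδ : 0 < δ)
    (hδ' : δ < 1 / 2) (hQ : Qᵀ * Q = 1) (hρ : 0 ≤ ρ) {x : Euc 3}
    (hx : x ∈ matVec Q '' baseDiamond 3 δ) :
    ‖rotatedMap Q M ρ μ δ x - matVec M x‖ ≤ ρ * (2 * (μ * δ)) := by
  obtain ⟨y, hy, rfl⟩ := hx
  rw [rotatedMap_sub M ρ hQ, norm_smul, norm_matVec hQ, Real.norm_of_nonneg hρ]
  exact mul_le_mul_of_nonneg_left (norm_modelMap_le hμ hμ' hδ hδ'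
    (abs_add_le_of_mem_baseDiamond hδ hy)) hρ

theorem iUnion_rotatedPiece (hμ : 0 < μ) (hμ' : μ ≤ 1 / 2) (hδ : 0 < δ)
    (hδ' : δ < 1 / 2) : matVec Q '' baseDiamond 3 δ = ⋃ i, rotatedPiece Q μ δ i := by
  rw [baseDiamond_eq_iUnion hμ hμ' hδ hδ', image_iUnion]
  rfl

theorem volume_rotatedPiece_inter (hμ : 0 < μ) (hμ' : μ ≤ 1 / 2) (hδ : 0 < δ)
    (hδ' : δ < 1 / 2) (hQ : Qᵀ * Q = 1) (hdet : Q.det = 1) {i j : Piece}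
    (hij : i ≠ j) : volume (rotatedPiece Q μ δ i ∩ rotatedPiece Q μ δ j) = 0 := by
  have hinj : Function.Injective (matVec Q) := (rotationHomeomorph Q hQ).injective
  rw [rotatedPiece, rotatedPiece, ← image_inter hinj, volume_image_matVec hdet,
    volume_piece_inter hμ hμ' hδ hδ' hij]

theorem volume_iUnion_rotatedPiece_inner (hμ : 0 < μ) (hμ' : μ ≤ 1 / 2) (hδ : 0 < δ)
    (hδ' : δ < 1 / 2) (hdet : Q.det = 1) :
    volume (⋃ i, ⋃ _ : IsInner i, rotatedPiece Q μ δ i) =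
      ENNReal.ofReal (μ * (1 - δ ^ 2)) * volume (matVec Q '' baseDiamond 3 δ) := by
  rw [volume_image_matVec hdet, ← volume_iUnion_inner hμ hμ' hδ hδ',
    ← volume_image_matVec hdet (⋃ i, ⋃ _, piece μ δ i), image_iUnion₂]
  rfl

theorem volume_iUnion_rotatedPiece_outer (hμ : 0 < μ) (hμ' : μ ≤ 1 / 2) (hδ : 0 < δ)
    (hδ' : δ < 1 / 2) (hdet : Q.det = 1) :
    volume (⋃ i, ⋃ _ : ¬IsInner i, rotatedPiece Q μ δ i) =
      ENNReal.ofReal (1 - μ * (1 - δ ^ 2)) * volume (matVec Q '' baseDiamond 3 δ) := by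
  rw [volume_image_matVec hdet, ← volume_iUnion_outer hμ hμ' hδ hδ',
    ← volume_image_matVec hdet (⋃ i, ⋃ _, piece μ δ i), image_iUnion₂]
  rfl

theorem ae_exists_mem_interior (hμ : 0 < μ) (hμ' : μ ≤ 1 / 2) (hδ : 0 < δ)
    (hδ' : δ < 1 / 2) (hQ : Qᵀ * Q = 1) (hdet : Q.det = 1) :
    ∀ᵐ x, x ∈ matVec Q '' baseDiamond 3 δ → ∃ i, x ∈ interior (rotatedPiece Q μ δ i) ∧
      ∀ j, x ∈ rotatedPiece Q μ δ j → j = i := by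
  have h1 : ∀ᵐ x, ∀ i, x ∉ frontier (rotatedPiece Q μ δ i) := ae_all_iff.2 fun i =>
    measure_eq_zero_iff_ae_notMem.1 <| Convex.addHaar_frontier _ <| by
      rw [rotatedPiece_eq]; exact convex_convexHull ℝ _
  have h2 : ∀ᵐ x, ∀ i j, i ≠ j → x ∉ rotatedPiece Q μ δ i ∩ rotatedPiece Q μ δ j :=
    ae_all_iff.2 fun i => ae_all_iff.2 fun j => Filter.eventually_imp_distrib_left.2 fun hij =>
      measure_eq_zero_iff_ae_notMem.1 (volume_rotatedPiece_inter hμ hμ' hδ hδ' hQ hdet hij)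
  filter_upwards [h1, h2] with x hx1 hx2 hx
  rw [iUnion_rotatedPiece hμ hμ' hδ hδ'] at hx
  obtain ⟨i, hi⟩ := mem_iUnion.1 hx
  refine ⟨i, by_contra fun h => hx1 i ⟨subset_closure hi, h⟩, fun j hj => by_contra fun hji => ?_⟩
  exact hx2 j i hji ⟨hj, hi⟩

end Rotated

/-- The construction when the fraction `μ` of the phase `X` is at most one half. -/
theorem exists_diamond_map_of_le_half {X Y : Mat 3} {a nv : Euc 3} (ha : a ≠ 0) (hnv : ‖nv‖ = 1)
    (hX : X.trace = 0) (hY : Y.trace = 0)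
    (hXY : X - Y = vecMulVec (fun i => a i) (fun j => nv j)) {μ δ : ℝ} (hμ : 0 < μ)
    (hμ' : μ ≤ 1 / 2) (hδ : 0 < δ) (hδ' : δ < 1 / 2) {M : Mat 3} (hM : M = μ • X + (1 - μ) • Y) :
    ∃ (Ω : Set (Euc 3)) (u : Euc 3 → Euc 3) (g : Euc 3 → Mat 3),
      IsDiamond 3 δ Ω ∧ IsPiecewiseAffine Ω u ∧
      (∀ x ∈ frontier Ω, u x = matVec M x) ∧
      (∀ᵐ x, x ∈ Ω → HasFDerivAt u (matCLM (g x)) x) ∧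
      (∀ᵐ x, x ∈ Ω → (g x).trace = 0) ∧
      (∀ᵐ x, x ∈ Ω → min (frobNorm (g x - X)) (frobNorm (g x - Y)) ≤ 3 * (μ * δ) * ‖a‖) ∧
      (∀ᵐ x, x ∈ Ω → frobNorm (g x - X) ≠ frobNorm (g x - Y)) ∧
      volume {x ∈ Ω | frobNorm (g x - X) < frobNorm (g x - Y)} =
        ENNReal.ofReal (μ * (1 - δ ^ 2)) * volume Ω ∧
      volume {x ∈ Ω | frobNorm (g x - Y) < frobNorm (g x - X)} =
        ENNReal.ofReal (1 - μ * (1 - δ ^ 2)) * volume Ω ∧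
      (∃ V : Finset (Mat 3), V.card ≤ 10 ∧ ∀ᵐ x, x ∈ Ω → g x ∈ V) ∧
      (∃ T : Fin 20 → Set (Euc 3),
        (∀ i, ∃ p q r s : Euc 3, T i = convexHull ℝ {p, q, r, s}) ∧
        AEPartition Ω T ∧
        ∀ i, ∃ (f : Euc 3 →ₗ[ℝ] Euc 3) (b : Euc 3), ∀ x ∈ T i, u x = f x + b) ∧
      (∀ x ∈ Ω, ‖u x - matVec M x‖ ≤ 2 * (μ * δ) * ‖a‖) := by
  classical
  obtain ⟨Q, hQ, hdet, hrot⟩ := exists_rotation ha hnv (by rw [← hXY, trace_sub, hX, hY, sub_zero])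
  rw [← hXY] at hrot
  have ha0 : 0 < ‖a‖ := norm_pos_iff.2 ha
  have single_eq (c : ℝ) : (Matrix.single 0 1 c : Mat 3) = c • Matrix.single 0 1 1 := by
    rw [Matrix.smul_single, smul_eq_mul, mul_one]
  let G : Piece → Mat 3 := rotatedGrad Q M ‖a‖ μ δ
  have subX (i) : frobNorm (G i - X) =
      ‖a‖ * frobNorm (pieceGrad μ δ i - Matrix.single 0 1 (1 - μ)) := by
    rw [← frobNorm_smul_conj hQ ha0.le, single_eq, Matrix.mul_sub, Matrix.sub_mul, smul_sub,
      Matrix.mul_smul, Matrix.smul_mul, smul_comm, ← hrot]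
    congr 1
    simp only [G, rotatedGrad, hM]
    module
  have subY (i) : frobNorm (G i - Y) =
      ‖a‖ * frobNorm (pieceGrad μ δ i + Matrix.single 0 1 μ) := by
    rw [← frobNorm_smul_conj hQ ha0.le, single_eq, Matrix.mul_add, Matrix.add_mul, smul_add,
      Matrix.mul_smul, Matrix.smul_mul, smul_comm, ← hrot]
    congr 1
    simp only [G, rotatedGrad, hM]
    module
  have inner_lt {i} (hi : IsInner i) : frobNorm (G i - X) < frobNorm (G i - Y) := by
    rw [subX, subY]
    exact mul_lt_mul_of_pos_left (frobNorm_lt_of_isInner hi) ha0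
  have outer_lt {i} (hi : ¬IsInner i) : frobNorm (G i - Y) < frobNorm (G i - X) := by
    rw [subX, subY]
    exact mul_lt_mul_of_pos_left (frobNorm_lt_of_not_isInner hμ hμ' hδ hδ' hi) ha0
  let T : Piece → Set (Euc 3) := rotatedPiece Q μ δ
  let g : Euc 3 → Mat 3 := fun x => if h : ∃ i, x ∈ interior (T i) then G h.choose else 0
  have hg : ∀ᵐ x, x ∈ matVec Q '' baseDiamond 3 δ →
      ∃ i, x ∈ interior (T i) ∧ g x = G i ∧ ∀ j, x ∈ T j → j = i := by
    filter_upwards [ae_exists_mem_interior hμ hμ' hδ hδ' hQ hdet] with x hx hxΩ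
    obtain ⟨i, hi, hu⟩ := hx hxΩ
    have h : ∃ i, x ∈ interior (T i) := ⟨i, hi⟩
    have hc : h.choose = i := hu _ (interior_subset h.choose_spec)
    exact ⟨i, hi, by simp only [g, dif_pos h, hc], hu⟩
  have hΩ : matVec Q '' baseDiamond 3 δ = ⋃ i, T i := iUnion_rotatedPiece hμ hμ' hδ hδ'
  have affine (i : Piece) : ∃ (f : Euc 3 →ₗ[ℝ] Euc 3) (b : Euc 3), ∀ x ∈ T i,
      rotatedMap Q M ‖a‖ μ δ x = f x + b :=
    ⟨Matrix.toEuclideanLin (G i), ‖a‖ • matVec Q (pieceOffset μ δ i), fun x hx =>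
      rotatedMap_of_mem M ‖a‖ hμ hμ' hδ hδ' hQ hx⟩
  let e : Fin 20 ≃ Piece := (Fintype.equivFinOfCardEq (by simp)).symm
  have hΩe : matVec Q '' baseDiamond 3 δ = ⋃ i, T (e i) := by
    rw [hΩ, e.surjective.iUnion_comp T]
  refine ⟨matVec Q '' baseDiamond 3 δ, rotatedMap Q M ‖a‖ μ δ, g, ?_, ?_, ?_, ?_, ?_, ?_, ?_, ?_,
    ?_, ?_, ?_, ?_⟩
  · exact ⟨0, 1, Q, one_pos, hQ, hdet, by simp⟩
  · refine ⟨(continuous_rotatedMap Q M ‖a‖ μ δ).continuousOn, 20, fun i => T (e i), fun i => ?_,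
      hΩe.subset, fun i => ?_⟩
    · have hf : ({matVec Q (pieceVertex μ δ (e i) 0), matVec Q (pieceVertex μ δ (e i) 1),
        matVec Q (pieceVertex μ δ (e i) 2), matVec Q (pieceVertex μ δ (e i) 3)} :
        Set (Euc 3)).Finite := by simp
      exact ⟨hf.toFinset, by rw [hf.coe_toFinset, ← rotatedPiece_eq]⟩
    · obtain ⟨f, b, h⟩ := affine (e i)
      exact ⟨f, b, fun x hx => h x hx.1⟩
  · exact fun x hx => rotatedMap_of_mem_frontier M ‖a‖ hμ hμ' hδ hδ' hQ hx
  · filter_upwards [hg] with x hx hxΩ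
    obtain ⟨i, hi, hgi, -⟩ := hx hxΩ
    rw [hgi]
    exact hasFDerivAt_rotatedMap M ‖a‖ hμ hμ' hδ hδ' hQ hi
  · filter_upwards [hg] with x hx hxΩ
    obtain ⟨i, hi, hgi, -⟩ := hx hxΩ
    rw [hgi]
    simp only [G, rotatedGrad, hM]
    rw [trace_add, trace_add, trace_smul, trace_smul, trace_smul, hX, hY, trace_mul_comm,
      ← Matrix.mul_assoc, hQ, Matrix.one_mul, trace_pieceGrad]
    simp
  · filter_upwards [hg] with x hx hxΩ
    obtain ⟨i, hi, hgi, -⟩ := hx hxΩ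
    rw [hgi, subX, subY, mul_comm _ ‖a‖]
    by_cases h : IsInner i
    · exact (min_le_left _ _).trans (mul_le_mul_of_nonneg_left
        (frobNorm_pieceGrad_sub_le hμ hμ' hδ hδ' h) ha0.le)
    · exact (min_le_right _ _).trans (mul_le_mul_of_nonneg_left
        (frobNorm_pieceGrad_add_le hμ hμ' hδ hδ' h) ha0.le)
  · filter_upwards [hg] with x hx hxΩ
    obtain ⟨i, hi, hgi, -⟩ := hx hxΩ
    rw [hgi]
    by_cases h : IsInner i
    exacts [(inner_lt h).ne, (outer_lt h).ne']
  · rw [← volume_iUnion_rotatedPiece_inner hμ hμ' hδ hδ' hdet]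
    refine measure_congr (Filter.eventuallyEq_set.2 ?_)
    filter_upwards [hg] with x hx
    constructor
    · rintro ⟨hxΩ, hlt⟩
      obtain ⟨i, hi, hgi, -⟩ := hx hxΩ
      rw [hgi] at hlt
      exact mem_iUnion₂.2 ⟨i, by_contra fun h => (outer_lt h).not_gt hlt, interior_subset hi⟩
    · intro hxu
      obtain ⟨j, hj, hxj⟩ := mem_iUnion₂.1 hxu
      have hxΩ := hΩ.superset (mem_iUnion.2 ⟨j, hxj⟩)
      obtain ⟨i, -, hgi, hu⟩ := hx hxΩ
      refine ⟨hxΩ, ?_⟩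
      rw [hgi, ← hu j hxj]
      exact inner_lt hj
  · rw [← volume_iUnion_rotatedPiece_outer hμ hμ' hδ hδ' hdet]
    refine measure_congr (Filter.eventuallyEq_set.2 ?_)
    filter_upwards [hg] with x hx
    constructor
    · rintro ⟨hxΩ, hlt⟩
      obtain ⟨i, hi, hgi, -⟩ := hx hxΩ
      rw [hgi] at hlt
      exact mem_iUnion₂.2 ⟨i, fun h => (inner_lt h).not_gt hlt, interior_subset hi⟩
    · intro hxu
      obtain ⟨j, hj, hxj⟩ := mem_iUnion₂.1 hxu
      have hxΩ := hΩ.superset (mem_iUnion.2 ⟨j, hxj⟩)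
      obtain ⟨i, -, hgi, hu⟩ := hx hxΩ
      refine ⟨hxΩ, ?_⟩
      rw [hgi, ← hu j hxj]
      exact outer_lt hj
  · obtain ⟨V, hV, hmem⟩ := card_range_pieceGrad_le μ δ
    refine ⟨V.image fun N => M + ‖a‖ • (Q * N * Qᵀ), Finset.card_image_le.trans hV, ?_⟩
    filter_upwards [hg] with x hx hxΩ
    obtain ⟨i, hi, hgi, -⟩ := hx hxΩ
    exact Finset.mem_image.2 ⟨_, hmem i, hgi.symm⟩
  · refine ⟨fun i => T (e i), fun i => ⟨_, _, _, _, rotatedPiece_eq Q μ δ (e i)⟩,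
      ⟨?_, ?_, fun i j hij => ?_⟩, fun i => affine (e i)⟩
    · rw [← hΩe, Set.sdiff_self, measure_empty]
    · rw [← hΩe, Set.sdiff_self, measure_empty]
    · exact volume_rotatedPiece_inter hμ hμ' hδ hδ' hQ hdet (e.injective.ne hij)
  · intro x hx
    rw [mul_comm]
    exact norm_rotatedMap_sub_le M ‖a‖ hμ hμ' hδ hδ' hQ ha0.le hx

theorem volume_setOf_le_eq_of_ae_ne {Ω : Set (Euc 3)} {f g : Euc 3 → ℝ}
    (h : ∀ᵐ x, x ∈ Ω → f x ≠ g x) :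
    volume {x ∈ Ω | f x ≤ g x} = volume {x ∈ Ω | f x < g x} := by
  refine measure_congr (Filter.eventuallyEq_set.2 ?_)
  filter_upwards [h] with x hx
  exact and_congr_right fun hxΩ => ⟨fun hle => lt_of_le_of_ne hle (hx hxΩ), le_of_lt⟩

/-- The divergence-free (linearised) Conti construction in 3D: for trace-free
rank-one connected `A, B` and `M = λA + (1−λ)B` there is a universal constant
`C > 0` such that for every `δ ∈ (0,1/2)` there are a diamond `Ω_δ` of aspect ratio
`1:δ:1` and a piecewise affine map `u` with affine boundary data `Mx`, vanishing
divergence, gradient `Cλ(1−λ)δ|a|`-close to `{A,B}` with the stated volume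
fractions, at most ten gradient values, subordinate to a partition into 20
simplices, and `‖u − Mx‖_{L^∞} ≤ Cδλ(1−λ)|a|`. -/
theorem conti_construction_3D :
    ∃ C : ℝ, 0 < C ∧
      ∀ (A B : Mat 3) (a nv : Euc 3), a ≠ 0 → ‖nv‖ = 1 →
        Matrix.trace A = 0 → Matrix.trace B = 0 →
        A - B = Matrix.vecMulVec (fun i => a i) (fun j => nv j) →
        ∀ lam : ℝ, lam ∈ Set.Ioo (0 : ℝ) 1 →
        ∀ M : Mat 3, M = lam • A + (1 - lam) • B →
        ∀ δ : ℝ, δ ∈ Set.Ioo (0 : ℝ) (1/2) →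
          ∃ (Ωδ : Set (Euc 3)) (u : Euc 3 → Euc 3) (g : Euc 3 → Mat 3),
            IsDiamond 3 δ Ωδ ∧ IsPiecewiseAffine Ωδ u ∧
            (∀ x ∈ frontier Ωδ, u x = matVec M x) ∧
            (∀ᵐ x, x ∈ Ωδ → HasFDerivAt u (matCLM (g x)) x) ∧
            (∀ᵐ x, x ∈ Ωδ → Matrix.trace (g x) = 0) ∧
            (∀ᵐ x, x ∈ Ωδ →
              min (frobNorm (g x - A)) (frobNorm (g x - B))
                ≤ C * lam * (1 - lam) * δ * ‖a‖) ∧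
            (∃ vA ∈ Set.Ioo (1/2 : ℝ) 2, ∃ vB ∈ Set.Ioo (1/2 : ℝ) 2,
              volume {x ∈ Ωδ | frobNorm (g x - A) < frobNorm (g x - B)}
                = ENNReal.ofReal (vA * lam) * volume Ωδ ∧
              volume {x ∈ Ωδ | frobNorm (g x - B) ≤ frobNorm (g x - A)}
                = ENNReal.ofReal (vB * (1 - lam)) * volume Ωδ) ∧
            (∃ V : Finset (Mat 3), V.card ≤ 10 ∧ ∀ᵐ x, x ∈ Ωδ → g x ∈ V) ∧
            (∃ T : Fin 20 → Set (Euc 3),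
              (∀ i, ∃ p q r s : Euc 3, T i = convexHull ℝ {p, q, r, s}) ∧
              AEPartition Ωδ T ∧
              ∀ i, ∃ (f : Euc 3 →ₗ[ℝ] Euc 3) (b : Euc 3), ∀ x ∈ T i, u x = f x + b) ∧
            (∀ x ∈ Ωδ, ‖u x - matVec M x‖ ≤ C * δ * lam * (1 - lam) * ‖a‖) := by
  refine ⟨6, by norm_num, fun A B a nv ha hnv hA hB hAB lam ⟨hl0, hl1⟩ M hM δ ⟨hδ, hδ'⟩ => ?_⟩
  have hδ2 : 0 < δ ^ 2 := by positivity
  have hδ2' : δ ^ 2 < 1 / 4 := by nlinarith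
  have bound {μ c : ℝ} (hμ : 0 < μ) (hμ' : μ ≤ 1 / 2) (hc : c ≤ 3) :
      c * (μ * δ) * ‖a‖ ≤ 6 * μ * (1 - μ) * δ * ‖a‖ := by
    refine mul_le_mul_of_nonneg_right ?_ (norm_nonneg a)
    have : 0 < μ * δ := by positivity
    nlinarith
  have major {μ : ℝ} (hμ : 0 < μ) (hμ' : μ ≤ 1 / 2) :
      (1 - μ * (1 - δ ^ 2)) / (1 - μ) ∈ Set.Ioo (1 / 2 : ℝ) 2 := by
    constructor
    · rw [lt_div_iff₀ (by linarith)]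
      nlinarith
    · rw [div_lt_iff₀ (by linarith)]
      nlinarith
  rcases le_total lam (1 / 2) with hl | hl
  · obtain ⟨Ω, u, g, hΩ, hu, hbd, hder, htr, hdist, hne, hvX, hvY, hV, hT, hnorm⟩ :=
      exists_diamond_map_of_le_half ha hnv hA hB hAB hl0 hl hδ hδ' hM
    refine ⟨Ω, u, g, hΩ, hu, hbd, hder, htr, ?_, ?_, hV, hT, fun x hx => ?_⟩
    · filter_upwards [hdist] with x hx hxΩ
      exact (hx hxΩ).trans (bound hl0 hl le_rfl)
    · refine ⟨1 - δ ^ 2, ⟨by linarith, by linarith⟩, _, major hl0 hl, ?_, ?_⟩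
      · rw [hvX, mul_comm lam]
      · rw [volume_setOf_le_eq_of_ae_ne (hne.mono fun x hx hxΩ => (hx hxΩ).symm), hvY,
          div_mul_cancel₀ _ (by linarith)]
    · linarith [hnorm x hx, bound hl0 hl (show (2 : ℝ) ≤ 3 by norm_num)]
  · have hm0 : 0 < 1 - lam := by linarith
    have hm : 1 - lam ≤ 1 / 2 := by linarith
    have hBA : B - A = vecMulVec (fun i => (-a) i) (fun j => nv j) := by
      rw [← neg_sub, hAB]
      ext i j
      simp [vecMulVec_apply]
    obtain ⟨Ω, u, g, hΩ, hu, hbd, hder, htr, hdist, hne, hvX, hvY, hV, hT, hnorm⟩ :=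
      exists_diamond_map_of_le_half (neg_ne_zero.2 ha) hnv hB hA hBA hm0 hm hδ hδ'
        (M := M) (by rw [hM, _root_.sub_sub_cancel, add_comm])
    rw [norm_neg] at hdist hnorm
    refine ⟨Ω, u, g, hΩ, hu, hbd, hder, htr, ?_, ?_, hV, hT, fun x hx => ?_⟩
    · filter_upwards [hdist] with x hx hxΩ
      rw [min_comm]
      linarith [hx hxΩ, bound hm0 hm le_rfl]
    · have hmaj := major hm0 hm
      rw [_root_.sub_sub_cancel] at hmaj
      refine ⟨_, hmaj, 1 - δ ^ 2, ⟨by linarith, by linarith⟩, ?_, ?_⟩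
      · rw [hvY, div_mul_cancel₀ _ (by linarith)]
      · rw [volume_setOf_le_eq_of_ae_ne hne, hvX, mul_comm (1 - lam)]
    · linarith [hnorm x hx, bound hm0 hm (show (2 : ℝ) ≤ 3 by norm_num)]
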